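/- arXiv:1902.05593 — 2 statements merged into one kernel-verified Lean document; each statement's English description precedes it below -/
import Mathlib

section
/- Let X be an n-dimensional real Banach space (n ≥ 2) whose Banach–Mazur distance from the Euclidean space ℓ_2^n satisfies d(X, ℓ_2^n) ≤ 1 + 1/(3(n+1)), and let λ ∈ (1, 1 + 1/(3(n+1))). Then every λ-equilateral set contained in the unit sphere of X consisting of at most n − 1 points can be extended to a λ-equilateral set contained in the unit sphere of X consisting of n points. -/
open Metric

noncomputable section

theorem bm_det_interp {E : Type*} [NormedAddCommGroup E] [NormedSpace ℝ E] [FiniteDimensional ℝ E]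
    (s : Finset ℝ) (hs : Module.finrank ℝ E < s.card) (A : E →L[ℝ] E) :
    (1 + A).det = ∑ t ∈ s, (1 + t • A).det * (Lagrange.basis s id t).eval 1 := by
  classical
  let b := Module.finBasis ℝ E
  let M := LinearMap.toMatrix b b (A : E →ₗ[ℝ] E)
  let P : Polynomial ℝ :=
    ((Polynomial.X : Polynomial ℝ) • M.map Polynomial.C +
      (1 : Matrix _ _ ℝ).map Polynomial.C).det
  have hP : ∀ t : ℝ, P.eval t = (1 + t • A).det := by
    intro t
    have h1 : (1 + t • A).det = (LinearMap.toMatrix b b ((1 + t • A : E →L[ℝ] E) : E →ₗ[ℝ] E)).det := by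
      rw [LinearMap.det_toMatrix]
    rw [h1]
    have h2 : LinearMap.toMatrix b b ((1 + t • A : E →L[ℝ] E) : E →ₗ[ℝ] E) = t • M + 1 := by
      have : ((1 + t • A : E →L[ℝ] E) : E →ₗ[ℝ] E) = t • (A : E →ₗ[ℝ] E) + LinearMap.id := by
        ext x; simp [add_comm]
      rw [this, map_add, map_smul, LinearMap.toMatrix_id]
    rw [h2]
    rw [← Polynomial.coe_evalRingHom, RingHom.map_det]
    congr 1
    ext i j
    by_cases h : i = j <;> simp [h] <;> exact mul_comm _ _
  have hdeg : P.degree < s.card := by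
    refine lt_of_le_of_lt Polynomial.degree_le_natDegree ?_
    have := Polynomial.natDegree_det_X_add_C_le M 1
    rw [Fintype.card_fin] at this
    exact_mod_cast lt_of_le_of_lt this hs
  have h := Lagrange.eq_interpolate (s := s) (v := id) (f := P) (Set.injOn_id _) hdeg
  have h1 := hP 1
  rw [one_smul] at h1
  rw [← h1]
  conv_lhs => rw [h]
  rw [Lagrange.interpolate_apply, Polynomial.eval_finsetSum]
  refine Finset.sum_congr rfl fun t _ => ?_
  simp [hP]

open MeasureTheory in
theorem bm_no_nonvanishing {E : Type*} [NormedAddCommGroup E] [InnerProductSpace ℝ E]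
    [FiniteDimensional ℝ E] (F : E → E) (hF : ContDiff ℝ 1 F) (h0 : ∀ x, F x ≠ 0)
    (R : ℝ) (hR : 0 < R) (hout : ∀ x, R ≤ ‖x‖ → F x = x) : False := by
  let _ : MeasurableSpace E := borel E
  have : BorelSpace E := ⟨rfl⟩
  let μ : Measure E := Measure.addHaar
  let B : Set E := closedBall 0 R
  have hBc : IsCompact B := isCompact_closedBall 0 R
  let r : E → E := fun x => (R * ‖F x‖⁻¹) • F x
  have hr : ContDiff ℝ 1 r := by
    refine ContDiff.smul ?_ hF
    exact contDiff_const.mul ((hF.norm ℝ h0).inv fun x => norm_ne_zero_iff.2 (h0 x))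
  have hrn : ∀ x, ‖r x‖ = R := by
    intro x
    have := norm_ne_zero_iff.2 (h0 x)
    simp only [r, norm_smul, norm_mul, norm_inv, norm_norm, Real.norm_of_nonneg hR.le]
    field_simp
  have hrs : ∀ x, ‖x‖ = R → r x = x := by
    intro x hx
    simp only [r, hout x hx.ge, hx]
    rw [mul_inv_cancel₀ hR.ne', one_smul]
  let g : E → E := fun x => r x - x
  have hg : ContDiff ℝ 1 g := hr.sub contDiff_id
  have hgd : Differentiable ℝ g := hg.differentiable one_ne_zero
  have hg'c : Continuous (fderiv ℝ g) := hg.continuous_fderiv one_ne_zero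
  obtain ⟨C, hC⟩ := hBc.exists_bound_of_continuousOn hg'c.continuousOn
  have hC0 : 0 ≤ C := le_trans (norm_nonneg _) (hC 0 (by simp [B, hR.le]))
  have hlip : ∀ x ∈ B, ∀ y ∈ B, ‖g x - g y‖ ≤ C * ‖x - y‖ := fun x hx y hy =>
    (convex_closedBall 0 R).norm_image_sub_le_of_norm_fderiv_le (fun z _ => hgd z) hC hy hx
  let G : E → E := B.indicator g
  have hGin : ∀ x ∈ B, G x = g x := fun x hx => Set.indicator_of_mem hx g
  have hGout : ∀ x, x ∉ B → G x = 0 := fun x hx => Set.indicator_of_notMem hx g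
  have hmix : ∀ x ∈ B, ∀ y, y ∉ B → ‖G x - G y‖ ≤ C * ‖x - y‖ := by
    intro x hx y hy
    have hx' : ‖x‖ ≤ R := by simpa [B] using hx
    have hy' : R < ‖y‖ := by simpa [B] using hy
    obtain ⟨s, hs, hs'⟩ : R ∈ (fun s : ℝ => ‖x + s • (y - x)‖) '' Set.Icc 0 1 := by
      apply intermediate_value_Icc zero_le_one (by fun_prop)
      simp [hx', hy'.le]
    simp only at hs'
    set z := x + s • (y - x) with hz
    have hzB : z ∈ B := by simp [B, hs']
    have hgz : g z = 0 := by simp [g, hrs z hs']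
    rw [hGin x hx, hGout y hy, ← hgz]
    refine (hlip x hx z hzB).trans ?_
    gcongr
    have : x - z = s • (x - y) := by rw [hz]; module
    rw [this, norm_smul, Real.norm_of_nonneg hs.1]
    exact mul_le_of_le_one_left (norm_nonneg _) hs.2
  have hGlip : ∀ x y, ‖G x - G y‖ ≤ C * ‖x - y‖ := by
    intro x y
    by_cases hx : x ∈ B <;> by_cases hy : y ∈ B
    · rw [hGin x hx, hGin y hy]; exact hlip x hx y hy
    · exact hmix x hx y hy
    · rw [norm_sub_rev, norm_sub_rev x]; exact hmix y hy x hx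
    · rw [hGout x hx, hGout y hy]; simp; positivity
  -- determinant positive near 1
  obtain ⟨δ, hδ, hδ'⟩ : ∃ δ > 0, ∀ A : E →L[ℝ] E, ‖A‖ < δ → 0 < (1 + A).det := by
    have hc : Continuous fun A : E →L[ℝ] E => (1 + A).det :=
      ContinuousLinearMap.continuous_det.comp (continuous_const.add continuous_id)
    have h1 : (0:ℝ) < (1 + (0 : E →L[ℝ] E)).det := by
      rw [add_zero]
      have : (1 : E →L[ℝ] E).det = 1 := by
        change LinearMap.det (LinearMap.id : E →ₗ[ℝ] E) = 1
        simp
      rw [this]; exact one_pos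
    have := hc.continuousAt.eventually (lt_mem_nhds h1)
    obtain ⟨δ, hδ, h⟩ := Metric.eventually_nhds_iff.1 this
    exact ⟨δ, hδ, fun A hA => h (by simpa using hA)⟩
  let t0 : ℝ := min (1/2) (δ/2) / (C + 1)
  have ht0 : 0 < t0 := by positivity
  have hkey : ∀ t ∈ Set.Icc 0 t0, ∫ x in B, (1 + t • fderiv ℝ g x).det ∂μ = μ.real B := by
    intro t ht
    have htC : t * C ≤ min (1/2) (δ/2) := by
      have h1 : t * (C+1) ≤ min (1/2) (δ/2) := (le_div_iff₀ (by positivity)).1 ht.2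
      nlinarith [ht.1]
    have htC1 : t * C ≤ 1/2 := htC.trans (min_le_left _ _)
    have htC2 : t * C ≤ δ/2 := htC.trans (min_le_right _ _)
    have hpos : ∀ x ∈ B, 0 < (1 + t • fderiv ℝ g x).det := by
      intro x hx
      apply hδ'
      rw [norm_smul, Real.norm_of_nonneg ht.1]
      have := mul_le_mul_of_nonneg_left (hC x hx) ht.1
      linarith
    let f : E → E := fun x => x + t • G x
    have happ : ApproximatesLinearOn f ((ContinuousLinearEquiv.refl ℝ E : E ≃L[ℝ] E) : E →L[ℝ] E)
        Set.univ (1/2) := by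
      intro x _ y _
      have : f x - f y - ((ContinuousLinearEquiv.refl ℝ E : E ≃L[ℝ] E) : E →L[ℝ] E) (x - y)
          = t • (G x - G y) := by
        simp [f]; module
      rw [this, norm_smul, Real.norm_of_nonneg ht.1]
      have := mul_le_mul_of_nonneg_left (hGlip x y) ht.1
      push_cast
      nlinarith [norm_nonneg (x - y)]
    have hc : Subsingleton E ∨ (1/2 : NNReal) < ‖(((ContinuousLinearEquiv.refl ℝ E : E ≃L[ℝ] E)).symm : E →L[ℝ] E)‖₊⁻¹ := by
      rcases subsingleton_or_nontrivial E with h | h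
      · exact Or.inl h
      · right
        have : ‖(((ContinuousLinearEquiv.refl ℝ E : E ≃L[ℝ] E)).symm : E →L[ℝ] E)‖₊ = 1 := by
          have : (((ContinuousLinearEquiv.refl ℝ E : E ≃L[ℝ] E)).symm : E →L[ℝ] E) = ContinuousLinearMap.id ℝ E := rfl
          rw [this]
          ext
          simp
        rw [this, inv_one]
        exact NNReal.half_lt_self one_ne_zero
    have hsurj : Function.Surjective f := happ.surjective hc
    have hinj : Set.InjOn f Set.univ := happ.injOn hc
    have hfout : ∀ x, x ∉ B → f x = x := fun x hx => by simp [f, hGout x hx]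
    have ht1 : t ≤ 1 := by
      refine ht.2.trans ?_
      rw [div_le_one (by positivity)]
      exact (min_le_left _ _).trans (by linarith)
    have hfB : ∀ x ∈ B, f x ∈ B := by
      intro x hx
      have : f x = (1 - t) • x + t • r x := by simp only [f, hGin x hx, g]; module
      rw [this]
      exact convex_closedBall 0 R hx (by simp [hrn]) (by linarith) ht.1 (by ring)
    have himg : f '' B = B := by
      apply Set.Subset.antisymm
      · rintro _ ⟨x, hx, rfl⟩; exact hfB x hx
      · intro y hy
        obtain ⟨x, rfl⟩ := hsurj y
        by_cases hx : x ∈ B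
        · exact ⟨x, hx, rfl⟩
        · rw [hfout x hx] at hy; exact absurd hy hx
    have hder : ∀ x ∈ B, HasFDerivWithinAt f (1 + t • fderiv ℝ g x) B x := by
      intro x hx
      have h1 : HasFDerivWithinAt (fun x => x + t • g x) (1 + t • fderiv ℝ g x) B x :=
        ((hasFDerivAt_id x).add ((hgd x).hasFDerivAt.const_smul t)).hasFDerivWithinAt
      exact h1.congr (fun y hy => by simp [f, hGin y hy]) (by simp [f, hGin x hx])
    have hcov := lintegral_abs_det_fderiv_eq_addHaar_image μ hBc.measurableSet hder
      (hinj.mono (Set.subset_univ _))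
    rw [himg] at hcov
    rw [integral_eq_lintegral_of_nonneg_ae, Measure.real, ← hcov]
    · congr 1
      refine setLIntegral_congr_fun hBc.measurableSet fun x hx => ?_
      simp only [abs_of_pos (hpos x hx)]
    · exact (ae_restrict_iff' hBc.measurableSet).2 (Filter.Eventually.of_forall fun x hx => (hpos x hx).le)
    · exact (ContinuousLinearMap.continuous_det.comp
        (continuous_const.add (hg'c.const_smul t))).aestronglyMeasurable
  have hint : ∀ t : ℝ, IntegrableOn (fun x => (1 + t • fderiv ℝ g x).det) B μ := fun t =>
    (ContinuousLinearMap.continuous_det.comp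
        (continuous_const.add (hg'c.const_smul t))).continuousOn.integrableOn_compact hBc
  obtain ⟨s, hsub, hscard⟩ := (Set.Icc_infinite ht0).exists_subset_card_eq (Module.finrank ℝ E + 1)
  have hone : ∫ x in B, (1 + fderiv ℝ g x).det ∂μ = μ.real B := by
    have h1 : ∀ x, (1 + fderiv ℝ g x).det = _ := fun x =>
      bm_det_interp s (by omega) (fderiv ℝ g x)
    simp_rw [h1]
    rw [integral_finsetSum]
    · simp_rw [integral_mul_const]
      rw [Finset.sum_congr rfl fun t ht => by rw [hkey t (hsub ht)], ← Finset.mul_sum,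
        ← Polynomial.eval_finsetSum]
      rw [Lagrange.sum_basis (Set.injOn_id _) (Finset.card_pos.1 (by omega))]
      simp
    · intro t _
      exact (hint t).mul_const _
  have hzero : ∀ x, (1 + fderiv ℝ g x).det = 0 := by
    intro x
    have hd : HasFDerivAt r (fderiv ℝ r x) x := (hr.differentiable one_ne_zero x).hasFDerivAt
    have hgx : 1 + fderiv ℝ g x = fderiv ℝ r x := by
      have : HasFDerivAt g (fderiv ℝ r x - 1) x := hd.sub (hasFDerivAt_id x)
      rw [this.fderiv]; abel
    rw [hgx]
    have horth : ∀ v, inner ℝ (r x) (fderiv ℝ r x v) = 0 := by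
      intro v
      have h1 := hd.norm_sq
      have h2 : HasFDerivAt (fun y => ‖r y‖ ^ 2) (0 : E →L[ℝ] ℝ) x := by
        simp_rw [hrn]; exact hasFDerivAt_const _ _
      have := congrArg (fun L : E →L[ℝ] ℝ => L v) (h1.unique h2)
      simpa using this
    by_contra hne
    have hsj : Function.Surjective (fderiv ℝ r x) := by
      have := LinearMap.isUnit_iff_isUnit_det (fderiv ℝ r x : E →ₗ[ℝ] E)
      have h2 := this.2 (isUnit_iff_ne_zero.2 hne)
      exact ((Module.End.isUnit_iff _).1 h2).2
    obtain ⟨v, hv⟩ := hsj (r x)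
    have h3 := horth v
    rw [hv, real_inner_self_eq_norm_sq, hrn] at h3
    exact hR.ne' (pow_eq_zero_iff two_ne_zero |>.1 h3)
  simp_rw [hzero] at hone
  rw [integral_zero] at hone
  have : 0 < μ.real B := by
    refine ENNReal.toReal_pos (measure_closedBall_pos μ 0 hR).ne' hBc.measure_lt_top.ne
  linarith

theorem bm_brouwer {E : Type*} [NormedAddCommGroup E] [InnerProductSpace ℝ E]
    [FiniteDimensional ℝ E] (f : E → E) (hf : Continuous f) (M : ℝ) (hM : ∀ x, ‖f x‖ ≤ M) :
    ∃ x, f x = x := by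
  by_contra hcon
  push Not at hcon
  have hM0 : 0 ≤ M := (norm_nonneg _).trans (hM 0)
  let χ : E → ℝ := fun x => max 0 (min 1 (M + 2 - ‖x‖))
  have hχ : Continuous χ := by fun_prop
  have hχ0 : ∀ x, 0 ≤ χ x := fun x => le_max_left _ _
  have hχ1 : ∀ x, χ x ≤ 1 := fun x => max_le zero_le_one (min_le_left _ _)
  have hne : ∀ x, x - χ x • f x ≠ 0 := by
    intro x hx
    have hx' : x = χ x • f x := sub_eq_zero.1 hx
    have h1 : ‖x‖ ≤ M := by
      rw [hx', norm_smul, Real.norm_of_nonneg (hχ0 x)]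
      exact (mul_le_of_le_one_left (norm_nonneg _) (hχ1 x)).trans (hM x)
    have h2 : χ x = 1 := by
      simp only [χ]
      rw [min_eq_left (by linarith), max_eq_right zero_le_one]
    rw [h2, one_smul] at hx'
    exact hcon x hx'.symm
  obtain ⟨p, hp, hpa, hps⟩ := Continuous.exists_contDiff_approx (f := fun x => χ x • f x)
    (ε := fun x => ‖x - χ x • f x‖) 1 (hχ.smul hf) (by fun_prop) (fun x => norm_pos_iff.2 (hne x))
  refine bm_no_nonvanishing (fun x => x - p x) (contDiff_id.sub hp) ?_ (M + 2) (by linarith) ?_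
  · intro x hx
    have := hpa x
    rw [← sub_eq_zero.1 hx, dist_eq_norm] at this
    exact lt_irrefl _ this
  · intro x hx
    have : p x = 0 := by
      by_contra h
      have h2 : χ x • f x ≠ 0 := hps h
      apply h2
      have : χ x = 0 := by
        simp only [χ]
        exact max_eq_left ((min_le_right _ _).trans (by linarith))
      rw [this, zero_smul]
    simp [this]

theorem bm_brouwer_box {κ : Type*} [Fintype κ] (a b : κ → ℝ) (hab : a ≤ b)
    (f : (κ → ℝ) → (κ → ℝ)) (hf : ContinuousOn f (Set.Icc a b))
    (hm : ∀ x ∈ Set.Icc a b, f x ∈ Set.Icc a b) : ∃ x ∈ Set.Icc a b, f x = x := by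
  let cl : (κ → ℝ) → (κ → ℝ) := fun x => a ⊔ (b ⊓ x)
  have hcl : Continuous cl := continuous_pi fun i =>
    continuous_const.max (continuous_const.min (continuous_apply i))
  have hcm : ∀ x, cl x ∈ Set.Icc a b := fun x => ⟨le_sup_left, sup_le hab inf_le_left⟩
  have hcf : ∀ x ∈ Set.Icc a b, cl x = x := fun x hx => by
    simp only [cl]; rw [inf_eq_right.2 hx.2, sup_eq_right.2 hx.1]
  have hc : Continuous fun x => f (cl x) := hf.comp_continuous hcl hcm
  let h : EuclideanSpace ℝ κ → EuclideanSpace ℝ κ :=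
    fun x => WithLp.toLp 2 (f (cl (WithLp.ofLp x)))
  have hh : Continuous h := by
    have := PiLp.continuous_toLp 2 (fun _ : κ => ℝ)
    have h2 := PiLp.continuous_ofLp 2 (fun _ : κ => ℝ)
    exact this.comp (hc.comp h2)
  have hK : IsCompact ((WithLp.toLp 2 : (κ → ℝ) → EuclideanSpace ℝ κ) '' Set.Icc a b) :=
    isCompact_Icc.image (PiLp.continuous_toLp 2 (fun _ : κ => ℝ))
  obtain ⟨M, hM⟩ := hK.isBounded.exists_norm_le
  obtain ⟨x, hx⟩ := bm_brouwer h hh M (fun x => hM _ ⟨_, hm _ (hcm _), rfl⟩)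
  have hx' : f (cl (WithLp.ofLp x)) = WithLp.ofLp x := congrArg WithLp.ofLp hx
  have hxI : WithLp.ofLp x ∈ Set.Icc a b := by rw [← hx']; exact hm _ (hcm _)
  exact ⟨_, hxI, by rw [hcf _ hxI] at hx'; exact hx'⟩

theorem bm_form {J : Type*} [Fintype J] (η : ℝ) (hη : 0 ≤ η) (w : J → ℝ) (D : J → J → ℝ)
    (hw : ∑ i, w i = 0) (hd : ∀ i, D i i = 0) (h1 : ∀ i j, i ≠ j → 1 ≤ D i j)
    (h2 : ∀ i j, i ≠ j → D i j ≤ 1 + 2 * η) :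
    ∑ i, ∑ j, w i * w j * D i j ≤ -((1 - η * (Fintype.card J - 2)) * ∑ i, w i ^ 2) := by
  classical
  have hterm : ∀ i j, w i * w j * D i j ≤ (1 + η) * (w i * w j) + η * (|w i| * |w j|)
      - (if i = j then (1 + 2 * η) * w i ^ 2 else 0) := by
    intro i j
    by_cases h : i = j
    · subst h
      rw [if_pos rfl, hd, ← pow_two |w i|, sq_abs]
      nlinarith
    · rw [if_neg h]
      have h3 : |D i j - (1 + η)| ≤ η := abs_le.2 ⟨by linarith [h1 i j h], by linarith [h2 i j h]⟩
      have h4 : w i * w j * (D i j - (1 + η)) ≤ |w i| * |w j| * η := by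
        refine (le_abs_self _).trans ?_
        rw [abs_mul, abs_mul]
        gcongr
      linarith
  refine (Finset.sum_le_sum fun i _ => Finset.sum_le_sum fun j _ => hterm i j).trans ?_
  have e1 : ∑ i, w i * ∑ j, w j = 0 := by
    rw [hw]; simp
  have e2 : ∑ i, |w i| * ∑ j, |w j| = (∑ i, |w i|) ^ 2 := by
    rw [← Finset.sum_mul, sq]
  have e3 : (∑ i, |w i|) ^ 2 ≤ Fintype.card J * ∑ i, w i ^ 2 := by
    have := sq_sum_le_card_mul_sum_sq (s := (Finset.univ : Finset J)) (f := fun i => |w i|)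
    simpa [sq_abs] using this
  simp only [Finset.sum_sub_distrib, Finset.sum_add_distrib, ← Finset.mul_sum, e1, e2,
    Finset.sum_ite_eq, Finset.mem_univ, if_true]
  nlinarith [mul_le_mul_of_nonneg_left e3 hη]

theorem bm_identity {J E : Type*} [Fintype J] [NormedAddCommGroup E] [InnerProductSpace ℝ E]
    (w : J → ℝ) (z : J → E) (hw : ∑ i, w i = 0) (hz : ∑ i, w i • z i = 0) :
    ∑ i, ∑ j, w i * w j * ‖z i - z j‖ ^ 2 = 0 := by
  have h : ∀ i j, w i * w j * ‖z i - z j‖ ^ 2 =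
      (w i * ‖z i‖ ^ 2) * w j + w i * (w j * ‖z j‖ ^ 2) - 2 * inner ℝ (w i • z i) (w j • z j) := by
    intro i j
    rw [norm_sub_sq_real, real_inner_smul_left, real_inner_smul_right]
    ring
  simp_rw [h, Finset.sum_sub_distrib, Finset.sum_add_distrib, ← Finset.mul_sum, ← inner_sum, hz,
    hw, ← Finset.sum_mul, hw]
  simp

theorem bm_linindep {ι E : Type*} [Fintype ι] [NormedAddCommGroup E] [InnerProductSpace ℝ E]
    (η : ℝ) (hη : 0 ≤ η) (hc : η * Fintype.card ι < 1) (q : ι → E)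
    (hq1 : ∀ i, 1 ≤ ‖q i‖ ^ 2) (hq2 : ∀ i, ‖q i‖ ^ 2 ≤ 1 + 2 * η)
    (hp1 : ∀ i j, i ≠ j → 1 ≤ ‖q i - q j‖ ^ 2) (hp2 : ∀ i j, i ≠ j → ‖q i - q j‖ ^ 2 ≤ 1 + 2 * η) :
    LinearIndependent ℝ q := by
  rw [Fintype.linearIndependent_iff]
  intro c hcq
  let z : Option ι → E := fun o => o.elim 0 q
  let w : Option ι → ℝ := fun o => o.elim (-∑ i, c i) c
  have hw : ∑ o, w o = 0 := by simp [w, Fintype.sum_option]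
  have hz : ∑ o, w o • z o = 0 := by simp [w, z, Fintype.sum_option, hcq]
  have h0 := bm_identity w z hw hz
  have h1 := bm_form η hη w (fun i j => ‖z i - z j‖ ^ 2) hw (by simp)
    (by
      rintro (_ | i) (_ | j) hij
      · simp at hij
      · simpa [z] using hq1 j
      · simpa [z] using hq1 i
      · simpa [z] using hp1 i j (by simpa using hij))
    (by
      rintro (_ | i) (_ | j) hij
      · simp at hij
      · simpa [z] using hq2 j
      · simpa [z] using hq2 i
      · simpa [z] using hp2 i j (by simpa using hij))
  rw [h0, Fintype.card_option] at h1
  push_cast at h1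
  have hs : ∑ o, w o ^ 2 ≤ 0 := by
    by_contra hcon
    push Not at hcon
    have : 0 < 1 - η * ((Fintype.card ι : ℝ) + 1 - 2) := by nlinarith
    have := mul_pos this hcon
    linarith
  have hs0 := le_antisymm hs (Finset.sum_nonneg fun o _ => sq_nonneg (w o))
  intro i
  have := (Finset.sum_eq_zero_iff_of_nonneg fun o _ => sq_nonneg (w o)).1 hs0 (some i)
    (Finset.mem_univ _)
  simpa [w] using this

theorem bm_height {ι E : Type*} [Fintype ι] [NormedAddCommGroup E] [InnerProductSpace ℝ E]
    (η : ℝ) (hη : 0 ≤ η) (hc : η * Fintype.card ι < 1) (q : ι → E)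
    (hq1 : ∀ i, 1 ≤ ‖q i‖ ^ 2) (hq2 : ∀ i, ‖q i‖ ^ 2 ≤ 1 + 2 * η)
    (hp1 : ∀ i j, i ≠ j → 1 ≤ ‖q i - q j‖ ^ 2) (hp2 : ∀ i j, i ≠ j → ‖q i - q j‖ ^ 2 ≤ 1 + 2 * η)
    (d : Option ι → ℝ) (hd1 : ∀ o, 1 ≤ d o) (hd2 : ∀ o, d o ≤ 1 + 2 * η) (c : ι → ℝ)
    (hy : ∀ i, 2 * inner ℝ (q i) (∑ j, c j • q j) = d none + ‖q i‖ ^ 2 - d (some i)) :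
    ‖∑ j, c j • q j‖ ^ 2 ≤ d none := by
  set y := ∑ j, c j • q j with hydef
  set ρ := ‖y‖ ^ 2 - d none with hρ
  have hyq : ∀ i, ‖y - q i‖ ^ 2 = d (some i) + ρ := by
    intro i
    rw [norm_sub_sq_real, real_inner_comm]
    linarith [hy i]
  let z : Option (Option ι) → E := fun o => o.elim y fun o => o.elim 0 q
  let w : Option (Option ι) → ℝ := fun o => o.elim 1 fun o => o.elim (-1 + ∑ i, c i) fun i => - c i
  let e : Option (Option ι) → ℝ := fun o => o.elim 1 fun _ => 0
  have hw : ∑ o, w o = 0 := by simp [w, Fintype.sum_option]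
  have hz : ∑ o, w o • z o = 0 := by simp [w, z, Fintype.sum_option, hydef]
  have hwe : ∑ o, w o * e o = 1 := by simp [w, e, Fintype.sum_option]
  have h0 := bm_identity w z hw hz
  let D : Option (Option ι) → Option (Option ι) → ℝ := fun i j =>
    ‖z i - z j‖ ^ 2 - ρ * (e i + e j - 2 * e i * e j)
  have hD1 : ∀ o, D none (some o) = d o := by
    rintro (_ | i)
    · simp [D, z, e, hρ]
    · simp [D, z, e, hyq]
  have hD2 : ∀ o, D (some o) none = d o := by
    rintro (_ | i)
    · simp [D, z, e, hρ]
    · simp [D, z, e, norm_sub_rev (q i) y, hyq]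
  have hD3 : ∀ i, D (some none) (some (some i)) = ‖q i‖ ^ 2 := by intro i; simp [D, z, e]
  have hD4 : ∀ i, D (some (some i)) (some none) = ‖q i‖ ^ 2 := by intro i; simp [D, z, e]
  have hD5 : ∀ i j, D (some (some i)) (some (some j)) = ‖q i - q j‖ ^ 2 := by
    intro i j; simp [D, z, e]
  have h1 := bm_form η hη w D hw (by
      rintro (_ | _ | i)
      · simp [D, e]
        right; ring
      · simp [D, e]
      · simp [D, e])
    (by
      rintro (_ | _ | i) (_ | _ | j) hij
      · simp at hij
      · rw [hD1]; exact hd1 _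
      · rw [hD1]; exact hd1 _
      · rw [hD2]; exact hd1 _
      · simp at hij
      · rw [hD3]; exact hq1 _
      · rw [hD2]; exact hd1 _
      · rw [hD4]; exact hq1 _
      · rw [hD5]; exact hp1 i j (by simpa using hij))
    (by
      rintro (_ | _ | i) (_ | _ | j) hij
      · simp at hij
      · rw [hD1]; exact hd2 _
      · rw [hD1]; exact hd2 _
      · rw [hD2]; exact hd2 _
      · simp at hij
      · rw [hD3]; exact hq2 _
      · rw [hD2]; exact hd2 _
      · rw [hD4]; exact hq2 _
      · rw [hD5]; exact hp2 i j (by simpa using hij))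
  have h2 : ∑ i, ∑ j, w i * w j * D i j = 2 * ρ := by
    have : ∀ i j, w i * w j * D i j = w i * w j * ‖z i - z j‖ ^ 2
        - ρ * ((w i * e i) * w j) - ρ * (w i * (w j * e j)) + 2 * ρ * ((w i * e i) * (w j * e j)) := by
      intro i j; simp only [D]; ring
    simp_rw [this, Finset.sum_add_distrib, Finset.sum_sub_distrib, h0, ← Finset.mul_sum, hw, hwe,
      ← Finset.sum_mul, hw, hwe]
    ring
  rw [h2, Fintype.card_option, Fintype.card_option] at h1
  push_cast at h1
  have h3 : 0 ≤ (1 - η * ((Fintype.card ι : ℝ) + 1 + 1 - 2)) * ∑ i, w i ^ 2 :=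
    mul_nonneg (by linarith) (Finset.sum_nonneg fun o _ => sq_nonneg (w o))
  linarith

theorem bm_point {ι E : Type*} [Fintype ι] [NormedAddCommGroup E] [InnerProductSpace ℝ E]
    [FiniteDimensional ℝ E] (hcard : Fintype.card ι < Module.finrank ℝ E)
    (η : ℝ) (hη : 0 ≤ η) (hc : η * Fintype.card ι < 1) (q : ι → E)
    (hq1 : ∀ i, 1 ≤ ‖q i‖ ^ 2) (hq2 : ∀ i, ‖q i‖ ^ 2 ≤ 1 + 2 * η)
    (hp1 : ∀ i j, i ≠ j → 1 ≤ ‖q i - q j‖ ^ 2)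
    (hp2 : ∀ i j, i ≠ j → ‖q i - q j‖ ^ 2 ≤ 1 + 2 * η) :
    ∃ x : (Option ι → ℝ) → E, Continuous x ∧ ∀ d : Option ι → ℝ, (∀ o, 1 ≤ d o) →
      (∀ o, d o ≤ 1 + 2 * η) →
      ‖x d‖ ^ 2 = d none ∧ ∀ i, ‖x d - q i‖ ^ 2 = d (some i) := by
  classical
  have hli := bm_linindep η hη hc q hq1 hq2 hp1 hp2
  have hdet : IsUnit (Matrix.gram ℝ q).det :=
    isUnit_iff_ne_zero.2 (Matrix.det_gram_ne_zero_iff_linearIndependent.2 hli)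
  obtain ⟨u, hu, huq⟩ : ∃ u : E, ‖u‖ = 1 ∧ ∀ i, inner ℝ (q i) u = 0 := by
    let K := Submodule.span ℝ (Set.range q)
    have hK : K ≠ ⊤ := by
      intro h
      have h1 : Module.finrank ℝ K ≤ Fintype.card ι := finrank_range_le_card q
      rw [h, finrank_top] at h1
      omega
    have hK2 : Kᗮ ≠ ⊥ := fun h => hK ((Submodule.orthogonal_eq_bot_iff).1 h)
    obtain ⟨v, hv, hv0⟩ := Submodule.exists_mem_ne_zero_of_ne_bot hK2
    refine ⟨‖v‖⁻¹ • v, norm_smul_inv_norm (𝕜 := ℝ) hv0, fun i => ?_⟩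
    rw [real_inner_smul_right, (Submodule.mem_orthogonal K v).1 hv (q i)
      (Submodule.subset_span ⟨i, rfl⟩), mul_zero]
  let b : (Option ι → ℝ) → ι → ℝ := fun d i => (d none + ‖q i‖ ^ 2 - d (some i)) / 2
  let c : (Option ι → ℝ) → ι → ℝ := fun d => Matrix.mulVec (Matrix.gram ℝ q)⁻¹ (b d)
  let y : (Option ι → ℝ) → E := fun d => ∑ j, c d j • q j
  have hyi : ∀ d i, inner ℝ (q i) (y d) = b d i := by
    intro d i
    have h1 : Matrix.mulVec (Matrix.gram ℝ q) (c d) = b d := by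
      simp only [c]
      rw [Matrix.mulVec_mulVec, Matrix.mul_nonsing_inv _ hdet, Matrix.one_mulVec]
    rw [← h1]
    simp only [y, inner_sum, real_inner_smul_right, Matrix.mulVec, dotProduct, Matrix.gram_apply]
    exact Finset.sum_congr rfl fun j _ => mul_comm _ _
  have hb : Continuous b := by
    simp only [b]; fun_prop
  have hcc : Continuous c := Continuous.matrix_mulVec continuous_const hb
  have hyc : Continuous y := continuous_finsetSum _ fun j _ =>
    ((continuous_apply j).comp hcc).smul continuous_const
  have hyu : ∀ d, inner ℝ (y d) u = 0 := by
    intro d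
    simp [y, sum_inner, real_inner_smul_left, huq]
  refine ⟨fun d => y d + Real.sqrt (d none - ‖y d‖ ^ 2) • u, by fun_prop, fun d hd1 hd2 => ?_⟩
  have hh := bm_height η hη hc q hq1 hq2 hp1 hp2 d hd1 hd2 (c d)
    (fun i => by rw [hyi d i]; simp only [b]; ring)
  have hnorm : ‖y d + Real.sqrt (d none - ‖y d‖ ^ 2) • u‖ ^ 2 = d none := by
    rw [norm_add_sq_real, real_inner_smul_right, hyu, norm_smul, hu, mul_one, Real.norm_eq_abs,
      sq_abs, Real.sq_sqrt (sub_nonneg.2 hh)]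
    ring
  refine ⟨hnorm, fun i => ?_⟩
  rw [norm_sub_sq_real, hnorm, real_inner_comm, inner_add_right, real_inner_smul_right, huq, hyi]
  simp only [b]
  ring

theorem bm_step {ι E : Type*} [Fintype ι] [NormedAddCommGroup E] [InnerProductSpace ℝ E]
    [FiniteDimensional ℝ E] (hcard : Fintype.card ι < Module.finrank ℝ E)
    (η : ℝ) (hη : 0 ≤ η) (hc : η * Fintype.card ι < 1) (q : ι → E)
    (N : E → ℝ) (hN : Continuous N) (D lam : ℝ) (hD : 1 ≤ D) (hl : 1 ≤ lam)
    (hN1 : ∀ z, N z ≤ ‖z‖) (hN2 : ∀ z, ‖z‖ ≤ D * N z) (hη2 : (lam * D) ^ 2 ≤ 1 + 2 * η)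
    (hq : ∀ i, N (q i) = 1) (hqq : ∀ i j, i ≠ j → N (q i - q j) = lam) :
    ∃ x, N x = 1 ∧ ∀ i, N (x - q i) = lam := by
  have hDl : D ≤ lam * D := by nlinarith
  have hsq : ∀ t : ℝ, 1 ≤ t → t ≤ lam * D → 1 ≤ t ^ 2 ∧ t ^ 2 ≤ 1 + 2 * η := by
    intro t h1 h2
    constructor <;> nlinarith
  have hA : ∀ i, 1 ≤ ‖q i‖ ^ 2 ∧ ‖q i‖ ^ 2 ≤ 1 + 2 * η := by
    intro i
    have h1 := hN1 (q i)
    have h2 := hN2 (q i)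
    rw [hq] at h1 h2
    exact hsq _ h1 (by linarith)
  have hB : ∀ i j, i ≠ j → 1 ≤ ‖q i - q j‖ ^ 2 ∧ ‖q i - q j‖ ^ 2 ≤ 1 + 2 * η := by
    intro i j hij
    have h1 := hN1 (q i - q j)
    have h2 := hN2 (q i - q j)
    rw [hqq i j hij] at h1 h2
    exact hsq _ (by linarith) (by linarith)
  obtain ⟨x, hx, hxd⟩ := bm_point hcard η hη hc q (fun i => (hA i).1) (fun i => (hA i).2)
    (fun i j h => (hB i j h).1) (fun i j h => (hB i j h).2)
  let m : Option ι → ℝ := fun o => o.elim 1 fun _ => lam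
  let p : Option ι → E := fun o => o.elim 0 q
  let X : (Option ι → ℝ) → E := fun s => x fun o => (m o * s o) ^ 2
  have hX : Continuous X := by
    refine hx.comp ?_
    fun_prop
  have hm1 : ∀ o, 1 ≤ m o := by rintro (_ | i) <;> simp [m, hl]
  have hml : ∀ o, m o ≤ lam := by rintro (_ | i) <;> simp [m, hl]
  have hXn : ∀ s ∈ Set.Icc (fun _ => 1 : Option ι → ℝ) (fun _ => D), ∀ o,
      ‖X s - p o‖ = m o * s o := by
    intro s hs
    have hs1 : ∀ o, 1 ≤ s o := hs.1
    have hs2 : ∀ o, s o ≤ D := hs.2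
    have hms : ∀ o, 1 ≤ m o * s o := fun o => by nlinarith [hm1 o, hs1 o]
    have hms2 : ∀ o, m o * s o ≤ lam * D := fun o =>
      mul_le_mul (hml o) (hs2 o) (by linarith [hs1 o]) (by linarith)
    obtain ⟨h1, h2⟩ := hxd (fun o => (m o * s o) ^ 2) (fun o => (hsq _ (hms o) (hms2 o)).1)
      (fun o => (hsq _ (hms o) (hms2 o)).2)
    intro o
    have h3 : ‖X s - p o‖ ^ 2 = (m o * s o) ^ 2 := by
      rcases o with _ | i
      · simpa [p, X] using h1
      · exact h2 i
    exact (pow_left_inj₀ (norm_nonneg _) (by linarith [hms o]) two_ne_zero).1 h3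
  have hNpos : ∀ z, 0 < ‖z‖ → 0 < N z := by
    intro z hz
    have := hN2 z
    by_contra h
    push Not at h
    nlinarith
  have hXpos : ∀ s ∈ Set.Icc (fun _ => 1 : Option ι → ℝ) (fun _ => D), ∀ o,
      0 < ‖X s - p o‖ := by
    intro s hs o
    rw [hXn s hs o]
    have := hs.1 o
    have : (0:ℝ) < s o := lt_of_lt_of_le one_pos this
    have := hm1 o
    positivity
  obtain ⟨s, hs, hfix⟩ := bm_brouwer_box (fun _ => 1 : Option ι → ℝ) (fun _ => D) (fun _ => hD)
    (fun s o => ‖X s - p o‖ / N (X s - p o))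
    (by
      refine continuousOn_pi.2 fun o => ContinuousOn.div ?_ ?_ ?_
      · exact (by fun_prop : Continuous fun s => ‖X s - p o‖).continuousOn
      · exact (hN.comp (hX.sub continuous_const)).continuousOn
      · intro s hs
        exact (hNpos _ (hXpos s hs o)).ne')
    (by
      intro s hs
      refine ⟨fun o => ?_, fun o => ?_⟩
      · exact (one_le_div (hNpos _ (hXpos s hs o))).2 (hN1 _)
      · exact (div_le_iff₀ (hNpos _ (hXpos s hs o))).2 (hN2 _))
  have hfin : ∀ o, N (X s - p o) = m o := by
    intro o
    have h1 := congrFun hfix o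
    have hNp := hNpos _ (hXpos s hs o)
    rw [div_eq_iff hNp.ne', hXn s hs o, mul_comm] at h1
    have : s o ≠ 0 := ne_of_gt (lt_of_lt_of_le one_pos (hs.1 o))
    exact (mul_left_cancel₀ this h1).symm
  refine ⟨X s, ?_, fun i => hfin (some i)⟩
  simpa [p, m] using hfin none

theorem bm_extend_one (n : ℕ) (hn : 2 ≤ n) (X : Type*)
    [NormedAddCommGroup X] [NormedSpace ℝ X]
    (D : ℝ) (T : X ≃L[ℝ] EuclideanSpace ℝ (Fin n))
    (hT : ‖(T : X →L[ℝ] EuclideanSpace ℝ (Fin n))‖ *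
          ‖(T.symm : EuclideanSpace ℝ (Fin n) →L[ℝ] X)‖ ≤ D) (hD : 1 ≤ D)
    (lam : ℝ) (hlam1 : 1 < lam) (hlD : (lam * D) ^ 2 ≤ 1 + 2 / ((n : ℝ) + 1))
    (S : Finset X) (hcard : S.card ≤ n - 1) (hsph : ∀ x ∈ S, ‖x‖ = 1)
    (heq : ∀ x ∈ S, ∀ y ∈ S, x ≠ y → ‖x - y‖ = lam) :
    ∃ v : X, ‖v‖ = 1 ∧ ∀ x ∈ S, ‖v - x‖ = lam := by
  let a := ‖(T.symm : EuclideanSpace ℝ (Fin n) →L[ℝ] X)‖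
  have hne : Nontrivial (EuclideanSpace ℝ (Fin n)) := by
    have : Nonempty (Fin n) := ⟨⟨0, by omega⟩⟩
    infer_instance
  have ha : 0 < a := by
    refine norm_pos_iff.2 fun h => ?_
    obtain ⟨z, hz⟩ := exists_ne (0 : EuclideanSpace ℝ (Fin n))
    apply hz
    have h1 := congrArg (fun L : EuclideanSpace ℝ (Fin n) →L[ℝ] X => L z) h
    simpa using h1
  let N : EuclideanSpace ℝ (Fin n) → ℝ := fun z => ‖T.symm (a⁻¹ • z)‖
  have hNT : ∀ x : X, N (a • T x) = ‖x‖ := by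
    intro x
    simp only [N]
    rw [smul_smul, inv_mul_cancel₀ ha.ne', one_smul, T.symm_apply_apply]
  obtain ⟨x, hx1, hx2⟩ := bm_step (ι := S) (E := EuclideanSpace ℝ (Fin n))
    (by rw [finrank_euclideanSpace_fin, Fintype.card_coe]; omega) (1 / ((n : ℝ) + 1))
    (by positivity)
    (by
      rw [Fintype.card_coe, one_div_mul_eq_div, div_lt_one (by positivity)]
      have : S.card < n + 1 := by omega
      exact_mod_cast this)
    (fun i => a • T i) N (by fun_prop) D lam hD hlam1.le
    (by
      intro z
      have h := (T.symm : EuclideanSpace ℝ (Fin n) →L[ℝ] X).le_opNorm (a⁻¹ • z)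
      rw [norm_smul, norm_inv, Real.norm_of_nonneg ha.le] at h
      change _ ≤ a * (a⁻¹ * ‖z‖) at h
      rw [mul_inv_cancel_left₀ ha.ne'] at h
      exact h)
    (by
      intro z
      have h := (T : X →L[ℝ] EuclideanSpace ℝ (Fin n)).le_opNorm (T.symm (a⁻¹ • z))
      have h2 : (T : X →L[ℝ] EuclideanSpace ℝ (Fin n)) (T.symm (a⁻¹ • z)) = a⁻¹ • z :=
        T.apply_symm_apply _
      rw [h2, norm_smul, norm_inv, Real.norm_of_nonneg ha.le, inv_mul_le_iff₀ ha] at h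
      refine h.trans ?_
      rw [← mul_assoc, mul_comm a]
      exact mul_le_mul_of_nonneg_right hT (norm_nonneg _))
    (by rw [mul_one_div]; exact hlD)
    (fun i => by rw [hNT]; exact hsph i i.2)
    (fun i j hij => by
      rw [← smul_sub, ← map_sub, hNT]
      exact heq i i.2 j j.2 fun h => hij (Subtype.ext h))
  refine ⟨T.symm (a⁻¹ • x), hx1, fun y hy => ?_⟩
  have := hx2 ⟨y, hy⟩
  rw [← this]
  simp only [N, smul_sub, map_sub]
  rw [smul_smul, inv_mul_cancel₀ ha.ne', one_smul, T.symm_apply_apply]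


/-- variant of the Brass–Dekster theorem. Let `X` be an
`n`-dimensional real Banach space (`n ≥ 2`) whose Banach–Mazur distance from `ℓ_2^n`
is at most `1 + 1/(3(n+1))`, and let `λ ∈ (1, 1 + 1/(3(n+1)))`. Then every
`λ`-equilateral set of at most `n − 1` points on the unit sphere of `X` extends to a
`λ`-equilateral set of `n` points on the unit sphere. -/
theorem equilateral_extension_of_bm_close (n : ℕ) (hn : 2 ≤ n) (X : Type*)
    [NormedAddCommGroup X] [NormedSpace ℝ X] [FiniteDimensional ℝ X]
    (hdim : Module.finrank ℝ X = n)
    (hbm : (⨅ T : X ≃L[ℝ] EuclideanSpace ℝ (Fin n),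
        ‖(T : X →L[ℝ] EuclideanSpace ℝ (Fin n))‖ *
          ‖(T.symm : EuclideanSpace ℝ (Fin n) →L[ℝ] X)‖) ≤ 1 + 1 / (3 * ((n : ℝ) + 1)))
    (lam : ℝ) (hlam1 : 1 < lam) (hlam2 : lam < 1 + 1 / (3 * ((n : ℝ) + 1)))
    (S : Finset X) (hcard : S.card ≤ n - 1) (hsph : (S : Set X) ⊆ sphere (0 : X) 1)
    (heq : ∀ x ∈ S, ∀ y ∈ S, x ≠ y → ‖x - y‖ = lam) :
    ∃ T : Finset X, S ⊆ T ∧ T.card = n ∧ (T : Set X) ⊆ sphere (0 : X) 1 ∧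
      ∀ x ∈ T, ∀ y ∈ T, x ≠ y → ‖x - y‖ = lam := by
  have hn1 : (0:ℝ) < (n:ℝ) + 1 := by positivity
  set a : ℝ := 1 / (3 * ((n : ℝ) + 1)) with ha
  have ha0 : 0 < a := by positivity
  have ha9 : a ≤ 1 / 9 := by
    rw [ha]
    apply one_div_le_one_div_of_le (by norm_num)
    have : (2:ℝ) ≤ n := by exact_mod_cast hn
    linarith
  have hna : 2 / ((n:ℝ) + 1) = 6 * a := by
    rw [ha]; field_simp; norm_num
  have hne : Nonempty (X ≃L[ℝ] EuclideanSpace ℝ (Fin n)) :=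
    ⟨ContinuousLinearEquiv.ofFinrankEq (by rw [hdim, finrank_euclideanSpace_fin])⟩
  obtain ⟨T, hT⟩ := exists_lt_of_ciInf_lt (lt_of_le_of_lt hbm (by linarith : 1 + a < 1 + 4 / 3 * a))
  have hlD : (lam * (1 + 4 / 3 * a)) ^ 2 ≤ 1 + 2 / ((n : ℝ) + 1) := by
    rw [hna]
    have h1 : lam * (1 + 4 / 3 * a) ≤ (1 + a) * (1 + 4 / 3 * a) :=
      mul_le_mul_of_nonneg_right hlam2.le (by linarith)
    have h2 : (1 + a) * (1 + 4 / 3 * a) ≤ 1 + 5 / 2 * a := by nlinarith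
    have h3 : (lam * (1 + 4 / 3 * a)) ^ 2 ≤ (1 + 5 / 2 * a) ^ 2 :=
      pow_le_pow_left₀ (by positivity) (h1.trans h2) 2
    nlinarith
  have hstep : ∀ k : ℕ, ∀ S : Finset X, S.card + k = n → (S : Set X) ⊆ sphere (0 : X) 1 →
      (∀ x ∈ S, ∀ y ∈ S, x ≠ y → ‖x - y‖ = lam) →
      ∃ T : Finset X, S ⊆ T ∧ T.card = n ∧ (T : Set X) ⊆ sphere (0 : X) 1 ∧
        ∀ x ∈ T, ∀ y ∈ T, x ≠ y → ‖x - y‖ = lam := by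
    classical
    intro k
    induction k with
    | zero => exact fun S hS h1 h2 => ⟨S, subset_rfl, hS, h1, h2⟩
    | succ k ih =>
      intro S hS h1 h2
      obtain ⟨v, hv1, hv2⟩ := bm_extend_one n hn X (1 + 4 / 3 * a) T hT.le (by linarith) lam hlam1
        hlD S (by omega) (fun x hx => by simpa using h1 hx) h2
      have hvS : v ∉ S := by
        intro h
        have := hv2 v h
        simp at this
        linarith
      obtain ⟨U, hU1, hU2⟩ := ih (insert v S)
        (by rw [Finset.card_insert_of_notMem hvS]; omega)
        (by
          intro x hx
          rcases Finset.mem_insert.1 (Finset.mem_coe.1 hx) with rfl | hx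
          · simpa using hv1
          · exact h1 hx)
        (by
          intro x hx y hy hxy
          rcases Finset.mem_insert.1 hx with rfl | hxS
          · rcases Finset.mem_insert.1 hy with rfl | hyS
            · exact absurd rfl hxy
            · exact hv2 y hyS
          · rcases Finset.mem_insert.1 hy with rfl | hyS
            · rw [norm_sub_rev]; exact hv2 x hxS
            · exact h2 x hxS y hyS hxy)
      exact ⟨U, (Finset.subset_insert v S).trans hU1, hU2⟩
  exact hstep (n - S.card) S (by omega) hsph heq

end
end

section
/- There exist a constant κ > 0 and n₀ ∈ ℕ such that for every n ≥ n₀ and every n-dimensional real Banach space X there are a number λ > 1 and a λ-equilateral set of unit vectors in X of cardinality at least κ·(log n)^{1/3}; consequently H'_α(X) ≥ e_c(X) ≥ κ·(log n)^{1/3}. -/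
open Metric

noncomputable section

/-- The strict antipodality condition (with gap `> 1`). -/
def StrictAntipProp {X : Type*} [NormedAddCommGroup X] [NormedSpace ℝ X] (S : Set X) : Prop :=
  ∀ x ∈ S, ∀ y ∈ S, x ≠ y → ∃ f : X →L[ℝ] ℝ, ‖f‖ ≤ 1 ∧
    1 < f x - f y ∧ ∀ z ∈ S, f y ≤ f z ∧ f z ≤ f x

/-- The strict antipodal Hadwiger number `H'_α(X)`. -/
def strictHalpha (X : Type*) [NormedAddCommGroup X] [NormedSpace ℝ X] : ℕ :=
  sSup {k : ℕ | ∃ S : Finset X, S.card = k ∧ (S : Set X) ⊆ sphere (0 : X) 1 ∧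
    StrictAntipProp (S : Set X)}

/-- `e_c(X)`: the largest cardinality of a `λ`-equilateral subset of the unit sphere of
`X` with `1 < λ ≤ 2`. -/
def ecNumber (X : Type*) [NormedAddCommGroup X] [NormedSpace ℝ X] : ℕ :=
  sSup {k : ℕ | ∃ lam : ℝ, 1 < lam ∧ lam ≤ 2 ∧ ∃ S : Finset X, S.card = k ∧
    (S : Set X) ⊆ sphere (0 : X) 1 ∧ ∀ x ∈ S, ∀ y ∈ S, x ≠ y → ‖x - y‖ = lam}

section helpers
open Set Module MeasureTheory ProbabilityTheory

theorem fp_lemma {ι : Type*} [Fintype ι] (F : ι → (ι → ℝ) → ℝ) (A : ι → ℝ) (ε η : ℝ)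
    (hε : 0 < ε) (hη0 : 0 ≤ η) (hη : η ≤ ε / 4) (hconv : ∀ i, ConvexOn ℝ univ (F i))
    (hb : ∀ i s, ‖s‖ ≤ 2 * ε → |F i s - A i - s i| ≤ η) :
    ∃ s : ι → ℝ, ‖s‖ ≤ ε ∧ ∀ i, F i s = A i := by
  set Φ : (ι → ℝ) → (ι → ℝ) := fun s i => -(F i s - A i - s i) with hΦ
  have hlip : LipschitzOnWith (2/3 : NNReal) Φ (closedBall 0 ε) := by
    apply LipschitzOnWith.of_dist_le_mul
    intro x hx y hy
    rw [dist_pi_le_iff (by positivity)]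
    intro i
    have hc : ConvexOn ℝ (ball (0 : ι → ℝ) (2 * ε)) (fun s => F i s - A i - s i) := by
      have h1 : ConvexOn ℝ (ball (0 : ι → ℝ) (2 * ε)) (F i) :=
        (hconv i).subset (subset_univ _) (convex_ball _ _)
      have h2 : ConcaveOn ℝ (ball (0 : ι → ℝ) (2 * ε)) (fun s => A i + s i) := by
        refine ⟨convex_ball _ _, ?_⟩
        intro x _ y _ a b _ _ hab
        simp only [smul_eq_mul, Pi.add_apply, Pi.smul_apply]
        have : A i = (a + b) * A i := by rw [hab, one_mul]
        nlinarith
      have := h1.sub h2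
      refine this.congr ?_
      intro s _
      simp only [Pi.sub_apply]; ring
    have := hc.lipschitzOnWith_of_abs_le (ε := 3 * ε / 4) (M := η) (by positivity) (by
      intro a ha
      rw [dist_zero_right] at ha
      exact hb i a ha.le)
    have hsub : closedBall (0 : ι → ℝ) ε ⊆ ball 0 (2 * ε - 3 * ε / 4) :=
      closedBall_subset_ball (by linarith)
    have h3 := this.dist_le_mul x (hsub hx) y (hsub hy)
    have h4 : ((2 * η / (3 * ε / 4)).toNNReal : ℝ) ≤ 2 / 3 := by
      rw [Real.coe_toNNReal _ (by positivity), div_le_iff₀ (by positivity)]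
      linarith
    simp only [hΦ, dist_neg_neg]
    refine h3.trans ?_
    push_cast
    gcongr
  have hmaps : MapsTo Φ (closedBall 0 ε) (closedBall 0 ε) := by
    intro s hs
    rw [mem_closedBall_zero_iff] at hs ⊢
    rw [pi_norm_le_iff_of_nonneg hε.le]
    intro i
    simp only [hΦ, norm_neg, Real.norm_eq_abs]
    linarith [hb i s (by linarith)]
  have hcw : ContractingWith (2/3 : NNReal) (hmaps.restrict Φ _ _) := by
    refine ⟨?_, ?_⟩
    · rw [← NNReal.coe_lt_coe]; push_cast; norm_num
    · exact hlip.mapsToRestrict hmaps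
  obtain ⟨s, hs, hfix, -⟩ := ContractingWith.exists_fixedPoint' (isClosed_closedBall.isComplete)
    hmaps hcw (x := 0) (by simp [hε.le]) (edist_ne_top _ _)
  refine ⟨s, by simpa using hs, fun i => ?_⟩
  have := congrFun hfix i
  simp only [hΦ] at this
  linarith

theorem det_one_add_proj {E : Type*} [NormedAddCommGroup E] [InnerProductSpace ℝ E]
    [FiniteDimensional ℝ E] (K : Submodule ℝ E) :
    LinearMap.det ((1 : E →ₗ[ℝ] E) + Kᗮ.starProjection.toLinearMap) = 2 ^ finrank ℝ Kᗮ := by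
  let e := K.prodEquivOfIsCompl _ K.isCompl_orthogonal
  let b := (finBasis ℝ K).prod (finBasis ℝ Kᗮ)
  have : LinearMap.toMatrix b b (e.symm ∘ₗ ((1 : E →ₗ[ℝ] E) + Kᗮ.starProjection.toLinearMap)
      ∘ₗ e.symm.symm) =
      Matrix.fromBlocks 1 0 0 ((2:ℝ) • 1) := by
    have h3 : ∀ x : K, Kᗮ.starProjection (x : E) = 0 := by
      intro x
      rw [Submodule.starProjection_apply_eq_zero_iff]
      simp
    have h4 : ∀ x : Kᗮ, Kᗮ.starProjection (x : E) = x := by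
      intro x
      rw [Submodule.starProjection_eq_self_iff]
      exact x.2
    ext (i | i) (j | j) <;>
    simp [LinearMap.toMatrix_apply, b, Matrix.one_apply, Finsupp.single_apply, h3, h4,
      eq_comm, e]
    split_ifs <;> norm_num
  rw [← LinearMap.det_conj _ e.symm, ← LinearMap.det_toMatrix b, this, Matrix.det_fromBlocks_zero₂₁,
    Matrix.det_one, one_mul, Matrix.det_smul, Fintype.card_fin, Matrix.det_one, mul_one]

theorem dvoretzky_rogers {X : Type*} [NormedAddCommGroup X] [NormedSpace ℝ X]
    [FiniteDimensional ℝ X] (n : ℕ) (hn : finrank ℝ X = n) (hn0 : 0 < n) :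
    ∃ m : ℕ, n ≤ 2 * m ∧ ∃ T : EuclideanSpace ℝ (Fin m) →L[ℝ] X, ‖T‖ ≤ 1 ∧
      ∀ j, 2 / 5 ≤ ‖T (EuclideanSpace.basisFun (Fin m) ℝ j)‖ := by
  let E := EuclideanSpace ℝ (Fin n)
  have hE : finrank ℝ E = n := by simp [E]
  let B : X ≃L[ℝ] E := ContinuousLinearEquiv.ofFinrankEq (by rw [hn, hE])
  let D : (E →L[ℝ] X) → ℝ := fun T => |LinearMap.det ((B.toContinuousLinearMap.comp T).toLinearMap)|
  have hDc : Continuous D := by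
    have h1 : Continuous (fun T : E →L[ℝ] X => B.toContinuousLinearMap.comp T) := by fun_prop
    have h2 : Continuous (fun S : E →L[ℝ] E => S.det) := by
      exact ContinuousLinearMap.continuous_det
    exact (h2.comp h1).abs
  obtain ⟨T, hT, hmax⟩ := (isCompact_closedBall (0 : E →L[ℝ] X) 1).exists_isMaxOn
    ⟨0, by simp⟩ hDc.continuousOn
  rw [mem_closedBall_zero_iff] at hT
  have hDsmul : ∀ (c : ℝ) (S : E →L[ℝ] X), D (c • S) = |c| ^ n * D S := by
    intro c S
    have : ((B.toContinuousLinearMap.comp (c • S)).toLinearMap) =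
      c • ((B.toContinuousLinearMap.comp S).toLinearMap) := by
      ext; simp
    simp only [D, this, LinearMap.det_smul, hE, abs_mul, abs_pow]
  have hpos : 0 < D T := by
    let S : E →L[ℝ] X := B.symm.toContinuousLinearMap
    have hS : D S = 1 := by
      have : ((B.toContinuousLinearMap.comp S).toLinearMap) = LinearMap.id := by
        ext; simp [S]
      change |LinearMap.det ((B.toContinuousLinearMap.comp S).toLinearMap)| = 1
      rw [this, LinearMap.det_id, abs_one]
    have h1 : ((‖S‖ + 1)⁻¹ • S) ∈ closedBall (0 : E →L[ℝ] X) 1 := by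
      rw [mem_closedBall_zero_iff, norm_smul, norm_inv, Real.norm_of_nonneg (by positivity),
        inv_mul_le_iff₀ (by positivity)]
      linarith
    have h2 : D ((‖S‖ + 1)⁻¹ • S) ≤ D T := hmax h1
    rw [hDsmul, hS] at h2
    refine lt_of_lt_of_le ?_ h2
    positivity
  have key : ∀ K : Submodule ℝ E, 2 * finrank ℝ K ≤ n →
      ∃ w ∈ Kᗮ, ‖w‖ = 1 ∧ 2 / 5 ≤ ‖T w‖ := by
    intro K hK
    by_contra! hcon
    have hw : ∀ w ∈ Kᗮ, ‖T w‖ ≤ 2 / 5 * ‖w‖ := by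
      intro w hw
      by_cases h0 : w = 0
      · simp [h0]
      have hnw : 0 < ‖w‖ := norm_pos_iff.2 h0
      have := hcon (‖w‖⁻¹ • w) (Kᗮ.smul_mem _ hw) (by
        rw [norm_smul, norm_inv, norm_norm, inv_mul_cancel₀ hnw.ne'])
      rw [map_smul, norm_smul, norm_inv, norm_norm, inv_mul_lt_iff₀ hnw] at this
      linarith
    let A : E →L[ℝ] E := 1 + Kᗮ.starProjection
    have hTA : ‖T.comp A‖ ≤ 7 / 5 := by
      refine ContinuousLinearMap.opNorm_le_bound _ (by norm_num) ?_
      intro x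
      have h1 : T.comp A x = T x + T (Kᗮ.starProjection x) := by simp [A]
      rw [h1]
      have h2 : ‖T x‖ ≤ ‖x‖ := by
        simpa using T.le_of_opNorm_le hT x
      have h3 := hw (Kᗮ.starProjection x) (Submodule.starProjection_apply_mem _ _)
      have h4 : ‖Kᗮ.starProjection x‖ ≤ ‖x‖ := by
        exact Submodule.norm_starProjection_apply_le _ _
      refine (norm_add_le _ _).trans ?_
      linarith
    have hmem : ((5 / 7 : ℝ) • T.comp A) ∈ closedBall (0 : E →L[ℝ] X) 1 := by
      rw [mem_closedBall_zero_iff, norm_smul, Real.norm_of_nonneg (by norm_num)]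
      linarith
    have h5 : D ((5 / 7 : ℝ) • T.comp A) ≤ D T := hmax hmem
    have h6 : D (T.comp A) = D T * 2 ^ finrank ℝ Kᗮ := by
      have : ((B.toContinuousLinearMap.comp (T.comp A)).toLinearMap) =
        ((B.toContinuousLinearMap.comp T).toLinearMap) *
          ((1 : E →ₗ[ℝ] E) + Kᗮ.starProjection.toLinearMap) := by
        ext; simp [A]
      change |LinearMap.det ((B.toContinuousLinearMap.comp (T.comp A)).toLinearMap)| = _
      rw [this, map_mul, abs_mul]
      have hd := det_one_add_proj K
      rw [hd, abs_of_pos (by positivity : (0:ℝ) < 2 ^ finrank ℝ Kᗮ)]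
    rw [hDsmul, h6, abs_of_pos (by norm_num)] at h5
    have h7 : (5 / 7 : ℝ) ^ n * 2 ^ finrank ℝ Kᗮ ≤ 1 := by
      by_contra! h
      nlinarith
    have h8 : finrank ℝ K + finrank ℝ Kᗮ = n := by
      rw [Submodule.finrank_add_finrank_orthogonal, hE]
    have h9 : ((5 / 7 : ℝ) ^ n * 2 ^ finrank ℝ Kᗮ) ^ 2 ≤ 1 := by
      apply pow_le_one₀ (by positivity) h7
    have h10 : (50 / 49 : ℝ) ^ n ≤ ((5 / 7 : ℝ) ^ n * 2 ^ finrank ℝ Kᗮ) ^ 2 := by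
      have : (50 / 49 : ℝ) ^ n = ((5/7) ^ n) ^ 2 * 2 ^ n := by
        rw [← pow_mul, mul_comm n 2, pow_mul, ← mul_pow]; norm_num
      rw [this, mul_pow, ← pow_mul 2]
      gcongr
      · norm_num
      · omega
    have h11 : (1 : ℝ) < (50 / 49) ^ n := one_lt_pow₀ (by norm_num) hn0.ne'
    linarith
  have ind : ∀ i : ℕ, 2 * i ≤ n + 1 → ∃ u : Fin i → E, Orthonormal ℝ u ∧ ∀ j, 2 / 5 ≤ ‖T (u j)‖ := by
    intro i
    induction i with
    | zero => intro _; exact ⟨Fin.elim0, ⟨fun j => j.elim0, fun j => j.elim0⟩, fun j => j.elim0⟩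
    | succ i ih =>
      intro hi
      obtain ⟨u, hu, hut⟩ := ih (by omega)
      have hfr : finrank ℝ (Submodule.span ℝ (range u)) = i := by
        rw [finrank_span_eq_card hu.linearIndependent, Fintype.card_fin]
      obtain ⟨w, hw, hw1, hwT⟩ := key (Submodule.span ℝ (range u)) (by omega)
      refine ⟨Fin.snoc u w, ?_, ?_⟩
      · have hin : ∀ j, inner ℝ (u j) w = 0 := fun j =>
          (Submodule.mem_orthogonal _ _).1 hw (u j) (Submodule.subset_span (mem_range_self j))
        constructor
        · intro j
          refine Fin.lastCases ?_ (fun j => ?_) j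
          · simpa using hw1
          · simpa using hu.1 j
        · intro j l
          refine Fin.lastCases ?_ (fun j => ?_) j
          · refine Fin.lastCases ?_ (fun l => ?_) l
            · simp
            · intro _
              simp only [Fin.snoc_last, Fin.snoc_castSucc]
              rw [real_inner_comm]; exact hin l
          · refine Fin.lastCases ?_ (fun l => ?_) l
            · intro _
              simpa using hin j
            · intro hjl
              simp only [Fin.snoc_castSucc]
              exact hu.2 (fun h => hjl (by rw [h]))
      · intro j
        refine Fin.lastCases ?_ (fun j => ?_) j
        · simpa using hwT
        · simpa using hut j
  obtain ⟨u, hu, hut⟩ := ind ((n + 1) / 2) (by omega)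
  refine ⟨(n + 1) / 2, by omega, ?_⟩
  let V : EuclideanSpace ℝ (Fin ((n + 1) / 2)) →ₗ[ℝ] E :=
    (EuclideanSpace.basisFun (Fin ((n + 1) / 2)) ℝ).toBasis.constr ℝ u
  have hV : ∀ j, V (EuclideanSpace.basisFun (Fin ((n + 1) / 2)) ℝ j) = u j := by
    intro j
    have := (EuclideanSpace.basisFun (Fin ((n + 1) / 2)) ℝ).toBasis.constr_basis ℝ u j
    simpa [V] using this
  have hVo : Orthonormal ℝ (V ∘ (EuclideanSpace.basisFun (Fin ((n + 1) / 2)) ℝ).toBasis) := by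
    convert hu using 1
    ext1 j
    simp only [Function.comp_apply, OrthonormalBasis.coe_toBasis]
    exact hV j
  let V' := V.isometryOfOrthonormal (v := (EuclideanSpace.basisFun (Fin ((n + 1) / 2)) ℝ).toBasis)
    (by simpa using (EuclideanSpace.basisFun (Fin ((n + 1) / 2)) ℝ).orthonormal) hVo
  refine ⟨T.comp V'.toContinuousLinearMap, ?_, ?_⟩
  · refine ContinuousLinearMap.opNorm_le_bound _ (by norm_num) ?_
    intro x
    have : ‖T (V' x)‖ ≤ 1 * ‖V' x‖ := T.le_of_opNorm_le hT _
    rw [V'.norm_map] at this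
    exact this
  · intro j
    have := hut j
    rw [← hV j] at this
    exact this

section conc
variable {E : Type*} [NormedAddCommGroup E] [InnerProductSpace ℝ E] [FiniteDimensional ℝ E]
  [MeasurableSpace E] [BorelSpace E]
variable {X : Type*} [NormedAddCommGroup X] [NormedSpace ℝ X]

theorem gauss_exp_norm_integrable (t : ℝ) :
    Integrable (fun x : E => Real.exp (t * ‖x‖)) (stdGaussian E) := by
  obtain ⟨C, hC, hIntg⟩ := IsGaussian.exists_integrable_exp_sq (stdGaussian E)
  refine (hIntg.const_mul (Real.exp (t ^ 2 / (4 * C)))).mono' (by fun_prop) ?_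
  refine Filter.Eventually.of_forall fun x => ?_
  rw [Real.norm_of_nonneg (Real.exp_pos _).le, ← Real.exp_add, Real.exp_le_exp]
  have : t ^ 2 / (4 * C) + C * ‖x‖ ^ 2 - t * ‖x‖ = (t - 2 * C * ‖x‖) ^ 2 / (4 * C) := by
    field_simp; ring
  have h2 : 0 ≤ (t - 2 * C * ‖x‖) ^ 2 / (4 * C) := by positivity
  linarith

theorem gauss_mgf (L : StrongDual ℝ E) (hL : ‖L‖ ≤ 1) (t : ℝ) :
    ∫⁻ x, ENNReal.ofReal (Real.exp (t * L x)) ∂(stdGaussian E)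
      ≤ ENNReal.ofReal (Real.exp (t ^ 2 / 2)) := by
  have h1 := IsGaussian.map_eq_gaussianReal (μ := stdGaussian E) L
  have h2 := mgf_gaussianReal h1 t
  have h3 : Integrable (fun x : E => Real.exp (t * L x)) (stdGaussian E) := by
    refine (gauss_exp_norm_integrable (E := E) |t|).mono' (by fun_prop) ?_
    refine Filter.Eventually.of_forall fun x => ?_
    rw [Real.norm_of_nonneg (Real.exp_pos _).le, Real.exp_le_exp]
    have : |L x| ≤ 1 * ‖x‖ := L.le_of_opNorm_le hL x
    calc t * L x ≤ |t * L x| := le_abs_self _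
      _ = |t| * |L x| := abs_mul _ _
      _ ≤ |t| * ‖x‖ := by gcongr; linarith
  rw [← ofReal_integral_eq_lintegral_ofReal h3
    (Filter.Eventually.of_forall fun x => (Real.exp_pos _).le)]
  apply ENNReal.ofReal_le_ofReal
  have h4 : ∫ x, Real.exp (t * L x) ∂(stdGaussian E) = mgf L (stdGaussian E) t := rfl
  rw [h4, h2, Real.exp_le_exp, integral_strongDual_stdGaussian, variance_dual_stdGaussian,
    Real.coe_toNNReal _ (by positivity)]
  have : ‖L‖ ^ 2 ≤ 1 := pow_le_one₀ (norm_nonneg _) hL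
  nlinarith [sq_nonneg t]

theorem gauss_step (T : E →L[ℝ] X) (hT : ‖T‖ ≤ 1) (a c s : ℝ) (ha : 0 ≤ a) (hc : 0 ≤ c) :
    ∫⁻ z : E × E, ENNReal.ofReal (Real.exp (a * (‖T z.1‖ - ‖T (c • z.1 + s • z.2)‖)))
      ∂((stdGaussian E).prod (stdGaussian E)) ≤
    ENNReal.ofReal (Real.exp ((a * s) ^ 2 / 2)) *
      ∫⁻ x, ENNReal.ofReal (Real.exp (a * (1 - c) * ‖T x‖)) ∂(stdGaussian E) := by
  rw [lintegral_prod _ (by fun_prop)]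
  have hm : Measurable (fun x : E => ENNReal.ofReal (Real.exp (a * (1 - c) * ‖T x‖))) :=
    ENNReal.measurable_ofReal.comp (Continuous.measurable (by fun_prop))
  rw [← lintegral_const_mul _ hm]
  apply lintegral_mono
  intro x
  obtain ⟨g, hg, hgx⟩ := exists_dual_vector'' ℝ (T x)
  have hgx' : g (T x) = ‖T x‖ := hgx
  have hL : ‖g.comp T‖ ≤ 1 := (g.opNorm_comp_le T).trans (by nlinarith [norm_nonneg g, norm_nonneg T])
  calc ∫⁻ y, ENNReal.ofReal (Real.exp (a * (‖T x‖ - ‖T (c • x + s • y)‖))) ∂(stdGaussian E)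
      ≤ ∫⁻ y, ENNReal.ofReal (Real.exp (a * (1 - c) * ‖T x‖)) *
          ENNReal.ofReal (Real.exp ((-(a * s)) * (g.comp T) y)) ∂(stdGaussian E) := by
        apply lintegral_mono
        intro y
        simp only
        rw [← ENNReal.ofReal_mul (Real.exp_pos _).le, ← Real.exp_add]
        apply ENNReal.ofReal_le_ofReal
        rw [Real.exp_le_exp]
        have h1 : g (T (c • x + s • y)) ≤ ‖T (c • x + s • y)‖ := by
          refine (le_abs_self _).trans ?_
          have := g.le_of_opNorm_le hg (T (c • x + s • y))
          rwa [one_mul] at this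
        have h2 : g (T (c • x + s • y)) = c * ‖T x‖ + s * g (T y) := by
          simp [hgx']
        rw [h2] at h1
        simp only [ContinuousLinearMap.comp_apply]
        have := mul_le_mul_of_nonneg_left h1 ha
        linarith
    _ = ENNReal.ofReal (Real.exp (a * (1 - c) * ‖T x‖)) *
          ∫⁻ y, ENNReal.ofReal (Real.exp ((-(a * s)) * (g.comp T) y)) ∂(stdGaussian E) := by
        rw [lintegral_const_mul _ (by fun_prop)]
    _ ≤ ENNReal.ofReal (Real.exp (a * (1 - c) * ‖T x‖)) * ENNReal.ofReal (Real.exp ((a * s) ^ 2 / 2)) := by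
        gcongr
        have := gauss_mgf (g.comp T) hL (-(a * s))
        rwa [neg_sq] at this
    _ = _ := mul_comm _ _

theorem gauss_diff (T : E →L[ℝ] X) (hT : ‖T‖ ≤ 1) (a : ℝ) (ha : 0 ≤ a) :
    ∫⁻ z : E × E, ENNReal.ofReal (Real.exp (a * (‖T z.1‖ - ‖T z.2‖)))
      ∂((stdGaussian E).prod (stdGaussian E)) ≤ ENNReal.ofReal (2 * Real.exp (5 / 4 * a ^ 2)) := by
  set μ := stdGaussian E with hμ
  set I : ℝ := ∫ x, Real.exp (1 * ‖x‖) ∂μ with hI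
  have hI0 : 0 ≤ I := integral_nonneg fun x => (Real.exp_pos _).le
  obtain ⟨K, hK⟩ := exists_nat_gt (2 * a * (I + 1))
  have hKpos : (0 : ℝ) < K := lt_of_le_of_lt (by positivity) hK
  set δ : ℝ := Real.pi / (2 * K) with hδ
  have hpi := Real.pi_pos
  have hpi4 : Real.pi ^ 2 < 10 := by nlinarith [Real.pi_lt_d2]
  have hδpos : 0 < δ := by positivity
  have hKδ : K * δ = Real.pi / 2 := by rw [hδ]; field_simp
  have hK1 : (1 : ℝ) ≤ K := by
    have : 0 < K := by exact_mod_cast hKpos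
    exact_mod_cast this
  have hδle : δ ≤ Real.pi / 2 := by nlinarith
  have hcos0 : 0 ≤ Real.cos δ := Real.cos_nonneg_of_mem_Icc ⟨by linarith, hδle⟩
  -- the single step
  have hstep : ∫⁻ z : E × E, ENNReal.ofReal (Real.exp ((a * K) *
      (‖T z.1‖ - ‖T (Real.cos δ • z.1 + Real.sin δ • z.2)‖))) ∂(μ.prod μ)
      ≤ ENNReal.ofReal (2 * Real.exp (5 / 4 * a ^ 2)) := by
    refine (gauss_step T hT (a * K) (Real.cos δ) (Real.sin δ) (by positivity) hcos0).trans ?_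
    rw [mul_comm 2, ENNReal.ofReal_mul (Real.exp_pos _).le]
    gcongr
    · have h1 : Real.sin δ ≤ δ := Real.sin_le hδpos.le
      have h2 : 0 ≤ Real.sin δ := Real.sin_nonneg_of_nonneg_of_le_pi hδpos.le (by linarith)
      have h3 : K * Real.sin δ ≤ Real.pi / 2 := by rw [← hKδ]; gcongr
      have h4 : (K * Real.sin δ) ^ 2 ≤ (Real.pi / 2) ^ 2 := by gcongr
      have h5 : (a * K * Real.sin δ) ^ 2 = a ^ 2 * (K * Real.sin δ) ^ 2 := by ring
      rw [h5]
      nlinarith [sq_nonneg a]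
    · set τ : ℝ := a * K * (1 - Real.cos δ) with hτ
      have hτ0 : 0 ≤ τ := by
        have := Real.cos_le_one δ
        have : 0 ≤ 1 - Real.cos δ := by linarith
        positivity
      have hτ1 : τ * (I + 1) ≤ 1 := by
        have h1 := Real.one_sub_sq_div_two_le_cos (x := δ)
        have h2 : τ ≤ a * K * (δ ^ 2 / 2) := by
          rw [hτ]; gcongr; linarith
        have h3 : a * K * (δ ^ 2 / 2) * K = a * (Real.pi ^ 2 / 8) := by
          have : a * K * (δ ^ 2 / 2) * K = a * (K * δ) ^ 2 / 2 := by ring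
          rw [this, hKδ]; ring
        have h4 : τ * K ≤ 2 * a := by
          have := mul_le_mul_of_nonneg_right h2 hKpos.le
          nlinarith
        by_contra! hcon
        have h5 : K * 1 < K * (τ * (I + 1)) := mul_lt_mul_of_pos_left hcon hKpos
        have h6 : τ * K * (I + 1) ≤ 2 * a * (I + 1) := by gcongr
        nlinarith
      have hτ2 : τ ≤ 1 := by nlinarith
      have hpt : ∀ x : E, Real.exp (τ * ‖T x‖) ≤ 1 + τ * Real.exp (1 * ‖x‖) := by
        intro x
        have h1 : ‖T x‖ ≤ ‖x‖ := by simpa using T.le_of_opNorm_le hT x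
        have h2 := convexOn_exp.2 (mem_univ (0 : ℝ)) (mem_univ ‖x‖) (sub_nonneg.2 hτ2) hτ0
          (by ring)
        simp only [smul_eq_mul, mul_zero, zero_add, Real.exp_zero, mul_one] at h2
        have h3 : Real.exp (τ * ‖T x‖) ≤ Real.exp (τ * ‖x‖) := by
          rw [Real.exp_le_exp]; gcongr
        rw [one_mul]
        linarith
      have hIntg : Integrable (fun x : E => 1 + τ * Real.exp (1 * ‖x‖)) μ :=
        (integrable_const _).add ((gauss_exp_norm_integrable 1).const_mul _)
      calc ∫⁻ x, ENNReal.ofReal (Real.exp (τ * ‖T x‖)) ∂μ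
          ≤ ∫⁻ x, ENNReal.ofReal (1 + τ * Real.exp (1 * ‖x‖)) ∂μ :=
            lintegral_mono fun x => ENNReal.ofReal_le_ofReal (hpt x)
        _ = ENNReal.ofReal (∫ x, (1 + τ * Real.exp (1 * ‖x‖)) ∂μ) :=
            (ofReal_integral_eq_lintegral_ofReal hIntg
              (Filter.Eventually.of_forall fun x => by positivity)).symm
        _ ≤ ENNReal.ofReal 2 := by
            apply ENNReal.ofReal_le_ofReal
            rw [integral_add (integrable_const _) ((gauss_exp_norm_integrable 1).const_mul _),
              integral_const_mul]
            simp only [integral_const, probReal_univ, smul_eq_mul, mul_one]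
            nlinarith
  -- the telescoping
  have hpoint : ∀ z : E × E, ENNReal.ofReal (Real.exp (a * (‖T z.1‖ - ‖T z.2‖))) ≤
      ∑ i ∈ Finset.range K, ENNReal.ofReal (K : ℝ)⁻¹ * ENNReal.ofReal (Real.exp ((a * K) *
      (‖T (ContinuousLinearMap.rotation (i * δ) z).1‖ -
        ‖T (Real.cos δ • (ContinuousLinearMap.rotation (i * δ) z).1 +
          Real.sin δ • (ContinuousLinearMap.rotation (i * δ) z).2)‖))) := by
    intro z
    set N : ℕ → ℝ := fun i => ‖T (ContinuousLinearMap.rotation (i * δ) z).1‖ with hN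
    have hrot : ∀ i : ℕ, ‖T (Real.cos δ • (ContinuousLinearMap.rotation (i * δ) z).1 +
          Real.sin δ • (ContinuousLinearMap.rotation (i * δ) z).2)‖ = N (i + 1) := by
      intro i
      simp only [hN, ContinuousLinearMap.rotation_apply]
      congr 2
      push_cast
      rw [add_mul, one_mul, Real.cos_add, Real.sin_add]
      module
    simp_rw [hrot]
    have h0 : ‖T z.1‖ = N 0 := by simp [hN, ContinuousLinearMap.rotation_apply]
    have h1 : ‖T z.2‖ = N K := by simp [hN, ContinuousLinearMap.rotation_apply, hKδ]
    rw [h0, h1, ← Finset.sum_range_sub']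
    simp_rw [← ENNReal.ofReal_mul (inv_nonneg.2 hKpos.le)]
    rw [← ENNReal.ofReal_sum_of_nonneg (fun i _ => by positivity)]
    apply ENNReal.ofReal_le_ofReal
    have hj := convexOn_exp.map_sum_le (t := Finset.range K) (w := fun _ => (K : ℝ)⁻¹)
      (p := fun i => a * K * (N i - N (i + 1))) (fun _ _ => by positivity)
      (by simp [hKpos.ne']) (fun _ _ => mem_univ _)
    simp only [smul_eq_mul] at hj
    refine le_trans (le_of_eq ?_) hj
    congr 1
    rw [Finset.mul_sum]
    apply Finset.sum_congr rfl
    intro i _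
    field_simp
  have hmp : ∀ θ : ℝ, (μ.prod μ).map (ContinuousLinearMap.rotation θ) = μ.prod μ :=
    fun θ => IsGaussian.map_rotation_eq_self (by simp [hμ]) θ
  refine (lintegral_mono hpoint).trans ?_
  rw [lintegral_finsetSum _ (fun i _ => by fun_prop)]
  have heach : ∀ i ∈ Finset.range K, ∫⁻ z : E × E, ENNReal.ofReal (K : ℝ)⁻¹ * ENNReal.ofReal (Real.exp ((a * K) *
      (‖T (ContinuousLinearMap.rotation (i * δ) z).1‖ -
        ‖T (Real.cos δ • (ContinuousLinearMap.rotation (i * δ) z).1 +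
          Real.sin δ • (ContinuousLinearMap.rotation (i * δ) z).2)‖))) ∂(μ.prod μ) ≤
       ENNReal.ofReal (K : ℝ)⁻¹ * ENNReal.ofReal (2 * Real.exp (5 / 4 * a ^ 2)) := by
    intro i _
    rw [lintegral_const_mul _ (by fun_prop)]
    gcongr
    refine le_trans (le_of_eq ?_) hstep
    conv_rhs => rw [← hmp (i * δ)]
    rw [lintegral_map (by fun_prop) (by fun_prop)]
  refine (Finset.sum_le_sum heach).trans (le_of_eq ?_)
  rw [Finset.sum_const, Finset.card_range, nsmul_eq_mul, ← mul_assoc]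
  have : (K : ENNReal) * ENNReal.ofReal (K : ℝ)⁻¹ = 1 := by
    rw [← ENNReal.ofReal_natCast, ← ENNReal.ofReal_mul hKpos.le, mul_inv_cancel₀ hKpos.ne',
      ENNReal.ofReal_one]
  rw [this, one_mul]

theorem gauss_exp_T_integrable (T : E →L[ℝ] X) (hT : ‖T‖ ≤ 1) (t M : ℝ) :
    Integrable (fun x : E => Real.exp (t * (‖T x‖ - M))) (stdGaussian E) := by
  refine ((gauss_exp_norm_integrable (E := E) |t|).const_mul (Real.exp (- (t * M)))).mono'
    (Continuous.aestronglyMeasurable (by fun_prop)) ?_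
  refine Filter.Eventually.of_forall fun x => ?_
  have h1 : ‖T x‖ ≤ ‖x‖ := by simpa using T.le_of_opNorm_le hT x
  rw [Real.norm_of_nonneg (Real.exp_pos _).le, ← Real.exp_add, Real.exp_le_exp]
  have h2 : t * ‖T x‖ ≤ |t| * ‖x‖ := by
    have := le_abs_self t
    have := abs_nonneg t
    nlinarith [norm_nonneg (T x)]
  linarith

theorem gauss_T_integrable (T : E →L[ℝ] X) :
    Integrable (fun x : E => ‖T x‖) (stdGaussian E) := by
  refine ((IsGaussian.integrable_id (μ := stdGaussian E)).norm.const_mul ‖T‖).mono'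
    (Continuous.aestronglyMeasurable (by fun_prop)) ?_
  refine Filter.Eventually.of_forall fun x => ?_
  rw [norm_norm]
  exact T.le_opNorm x

theorem gauss_lower_one (T : E →L[ℝ] X) (hT : ‖T‖ ≤ 1) (t : ℝ) :
    1 ≤ ∫⁻ x, ENNReal.ofReal (Real.exp (t * (‖T x‖ - ∫ y, ‖T y‖ ∂(stdGaussian E))))
      ∂(stdGaussian E) := by
  set M := ∫ y, ‖T y‖ ∂(stdGaussian E) with hM
  rw [← ofReal_integral_eq_lintegral_ofReal (gauss_exp_T_integrable T hT t M)
    (Filter.Eventually.of_forall fun x => (Real.exp_pos _).le), ← ENNReal.ofReal_one]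
  apply ENNReal.ofReal_le_ofReal
  have hi : Integrable (fun x : E => t * (‖T x‖ - M)) (stdGaussian E) :=
    ((gauss_T_integrable T).sub (integrable_const _)).const_mul _
  calc (1 : ℝ) = ∫ x, (t * (‖T x‖ - M) + 1) ∂(stdGaussian E) := by
        rw [integral_add hi (integrable_const _), integral_const_mul,
          integral_sub (gauss_T_integrable T) (integrable_const _)]
        simp [hM]
    _ ≤ _ := integral_mono (hi.add (integrable_const _)) (gauss_exp_T_integrable T hT t M)
        fun x => Real.add_one_le_exp _

theorem gauss_mgf_bound (T : E →L[ℝ] X) (hT : ‖T‖ ≤ 1) (a : ℝ) :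
    ∫⁻ x, ENNReal.ofReal (Real.exp (a * (‖T x‖ - ∫ y, ‖T y‖ ∂(stdGaussian E))))
      ∂(stdGaussian E) ≤ ENNReal.ofReal (2 * Real.exp (5 / 4 * a ^ 2)) := by
  set M := ∫ y, ‖T y‖ ∂(stdGaussian E) with hM
  have hm : ∀ t : ℝ, Measurable (fun x : E => ENNReal.ofReal (Real.exp (t * (‖T x‖ - M)))) :=
    fun t => ENNReal.measurable_ofReal.comp (Continuous.measurable (by fun_prop))
  have hprod : ∀ t : ℝ, ∫⁻ z : E × E, ENNReal.ofReal (Real.exp (t * (‖T z.1‖ - ‖T z.2‖)))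
      ∂((stdGaussian E).prod (stdGaussian E)) =
      (∫⁻ x, ENNReal.ofReal (Real.exp (t * (‖T x‖ - M))) ∂(stdGaussian E)) *
      ∫⁻ x, ENNReal.ofReal (Real.exp ((-t) * (‖T x‖ - M))) ∂(stdGaussian E) := by
    intro t
    rw [← lintegral_prod_mul (hm t).aemeasurable (hm (-t)).aemeasurable]
    congr 1
    ext z
    rw [← ENNReal.ofReal_mul (Real.exp_pos _).le, ← Real.exp_add]
    congr 2
    ring
  have hl := fun t => gauss_lower_one T hT t
  rcases le_total 0 a with h | h
  · refine le_trans ?_ (gauss_diff T hT a h)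
    rw [hprod]
    exact le_mul_of_one_le_right' (hl _)
  · have := gauss_diff T hT (-a) (by linarith)
    rw [neg_sq] at this
    refine le_trans ?_ this
    rw [hprod, neg_neg]
    exact le_mul_of_one_le_left' (hl _)

theorem gauss_conc (T : E →L[ℝ] X) (hT : ‖T‖ ≤ 1) (s : ℝ) (hs : 0 ≤ s) :
    (stdGaussian E) {x | s ≤ |‖T x‖ - ∫ y, ‖T y‖ ∂(stdGaussian E)|} ≤
      ENNReal.ofReal (4 * Real.exp (- (s ^ 2 / 5))) := by
  set M := ∫ y, ‖T y‖ ∂(stdGaussian E) with hM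
  have hm : ∀ t : ℝ, Measurable (fun x : E => ENNReal.ofReal (Real.exp (t * (‖T x‖ - M)))) :=
    fun t => ENNReal.measurable_ofReal.comp (Continuous.measurable (by fun_prop))
  have hone : ∀ σ : ℝ, σ ^ 2 = 1 → (stdGaussian E) {x | s ≤ σ * (‖T x‖ - M)} ≤
      ENNReal.ofReal (2 * Real.exp (- (s ^ 2 / 5))) := by
    intro σ hσ
    have h1 : (stdGaussian E) {x | s ≤ σ * (‖T x‖ - M)} ≤ (stdGaussian E)
        {x | ENNReal.ofReal (Real.exp (2 / 5 * s * s)) ≤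
          ENNReal.ofReal (Real.exp ((2 / 5 * s * σ) * (‖T x‖ - M)))} := by
      apply measure_mono
      intro x hx
      simp only [mem_ofPred_eq] at hx ⊢
      apply ENNReal.ofReal_le_ofReal
      rw [Real.exp_le_exp]
      have := mul_le_mul_of_nonneg_left hx (by positivity : 0 ≤ 2 / 5 * s)
      linarith
    have h2 := mul_meas_ge_le_lintegral₀ (μ := stdGaussian E) (hm (2 / 5 * s * σ)).aemeasurable
      (ENNReal.ofReal (Real.exp (2 / 5 * s * s)))
    have h3 := h2.trans (gauss_mgf_bound T hT (2 / 5 * s * σ))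
    refine h1.trans ?_
    have h4 : ENNReal.ofReal (2 * Real.exp (- (s ^ 2 / 5))) =
        ENNReal.ofReal (2 * Real.exp (5 / 4 * (2 / 5 * s * σ) ^ 2)) /
          ENNReal.ofReal (Real.exp (2 / 5 * s * s)) := by
      rw [← ENNReal.ofReal_div_of_pos (Real.exp_pos _), mul_div_assoc, ← Real.exp_sub]
      congr 3
      rw [mul_pow, hσ]
      ring
    rw [h4, ENNReal.le_div_iff_mul_le (Or.inl (by simp [Real.exp_pos])) (Or.inl (by simp)), mul_comm]
    exact h3
  have hsub : {x : E | s ≤ |‖T x‖ - M|} ⊆ {x | s ≤ 1 * (‖T x‖ - M)} ∪ {x | s ≤ (-1) * (‖T x‖ - M)} := by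
    intro x hx
    simp only [mem_ofPred_eq, mem_union] at hx ⊢
    rcases le_abs.1 hx with h | h
    · left; linarith
    · right; linarith
  refine (measure_mono hsub).trans ((measure_union_le _ _).trans
    ((add_le_add (hone 1 (by norm_num)) (hone (-1) (by norm_num))).trans (le_of_eq ?_)))
  rw [← ENNReal.ofReal_add (by positivity) (by positivity)]
  congr 1; ring

/-- law of a linear combination of independent standard Gaussian vectors -/
theorem gauss_comb {k : ℕ} (c : Fin k → ℝ) :
    (Measure.pi (fun _ : Fin k => stdGaussian E)).map (fun ω => ∑ l, c l • ω l) =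
      (stdGaussian E).map (fun x => √(∑ l, c l ^ 2) • x) := by
  have hms : Measurable (fun ω : Fin k → E => ∑ l, c l • ω l) :=
    Finset.measurable_sum _ (fun l _ => (measurable_pi_apply l).const_smul (c l))
  have hp : IsProbabilityMeasure ((Measure.pi (fun _ : Fin k => stdGaussian E)).map (fun ω => ∑ l, c l • ω l)) :=
    Measure.isProbabilityMeasure_map hms.aemeasurable
  have hp2 : IsProbabilityMeasure ((stdGaussian E).map (fun x => √(∑ l, c l ^ 2) • x)) :=
    Measure.isProbabilityMeasure_map (by fun_prop)
  apply Measure.ext_of_charFun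
  ext t
  have h := fun s : E => charFun_stdGaussian (E := E) s
  rw [charFun_map_smul, h, charFun_apply, integral_map hms.aemeasurable (by fun_prop)]
  simp_rw [sum_inner, Complex.ofReal_sum, Finset.sum_mul, Complex.exp_sum]
  rw [integral_fintype_prod_eq_prod (f := fun l (x : E) => Complex.exp ((inner ℝ (c l • x) t : ℝ) * Complex.I))]
  have : ∀ l, ∫ x : E, Complex.exp ((inner ℝ (c l • x) t : ℝ) * Complex.I) ∂(stdGaussian E) =
      Complex.exp (- ‖c l • t‖ ^ 2 / 2) := by
    intro l
    rw [← h, charFun_apply]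
    simp_rw [real_inner_smul_left, real_inner_smul_right]
  simp_rw [this]
  rw [← Complex.exp_sum]
  congr 1
  simp_rw [norm_smul]
  rw [← Finset.sum_div, Finset.sum_neg_distrib]
  congr 2
  norm_cast
  rw [mul_pow, Real.norm_of_nonneg (Real.sqrt_nonneg _), Real.sq_sqrt (by positivity), Finset.sum_mul]
  simp [mul_pow]

end conc

theorem gauss_tail_lower (t : ℝ) (ht : 0 ≤ t) :
    Real.exp (-((t + 1) ^ 2 / 2)) / 3 ≤ 1 - (gaussianReal 0 1).real (Ioo (-t) t) := by
  have h1 : (gaussianReal 0 1).real (Icc t (t + 1)) ≤ 1 - (gaussianReal 0 1).real (Ioo (-t) t) := by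
    rw [← probReal_compl_eq_one_sub measurableSet_Ioo]
    refine measureReal_mono (fun x hx hx2 => ?_) (measure_ne_top _ _)
    exact absurd hx.1 (not_le.2 hx2.2)
  refine le_trans ?_ h1
  rw [measureReal_def, gaussianReal_apply_eq_integral _ (by norm_num)]
  rw [ENNReal.toReal_ofReal (integral_nonneg fun x => gaussianPDFReal_nonneg _ _ _)]
  have h2 : ∫ x in Icc t (t + 1), Real.exp (-((t + 1) ^ 2 / 2)) / 3 ≤
      ∫ x in Icc t (t + 1), gaussianPDFReal 0 1 x := by
    apply setIntegral_mono_on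
    · exact (integrableOn_const (by simp))
    · exact (integrable_gaussianPDFReal 0 1).integrableOn
    · exact measurableSet_Icc
    · intro x hx
      rw [gaussianPDFReal]
      simp only [NNReal.coe_one, mul_one, sub_zero]
      have h3 : √(2 * Real.pi) ≤ 3 := by
        rw [Real.sqrt_le_left (by norm_num)]
        nlinarith [Real.pi_lt_d2]
      have h4 : 0 < √(2 * Real.pi) := Real.sqrt_pos.2 (by positivity)
      rw [div_eq_inv_mul]
      gcongr
      rw [neg_div]
      have : x ^ 2 ≤ (t + 1) ^ 2 := by
        have := hx.1; have := hx.2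
        gcongr
        linarith
      linarith
  simpa using h2

theorem gauss_max_lower (m : ℕ) (t : ℝ) (ht : 0 ≤ t)
    (hm : 3 * Real.exp ((t + 1) ^ 2 / 2) ≤ m) :
    ENNReal.ofReal (1 / 2) ≤ (Measure.pi (fun _ : Fin m => gaussianReal 0 1))
      {x | ∃ j, t ≤ |x j|} := by
  have hset : {x : Fin m → ℝ | ∃ j, t ≤ |x j|} = (univ.pi (fun _ => Ioo (-t) t))ᶜ := by
    ext x
    simp only [mem_ofPred_eq, mem_compl_iff, mem_univ_pi, mem_Ioo, ← abs_lt, not_forall, not_lt]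
  have hms : MeasurableSet (univ.pi (fun _ : Fin m => Ioo (-t) t)) :=
    MeasurableSet.univ_pi fun _ => measurableSet_Ioo
  rw [hset, ← ofReal_measureReal]
  apply ENNReal.ofReal_le_ofReal
  rw [probReal_compl_eq_one_sub hms, measureReal_def, Measure.pi_pi]
  simp only [Finset.prod_const, Finset.card_univ, Fintype.card_fin, ENNReal.toReal_pow]
  rw [← measureReal_def]
  have h1 := gauss_tail_lower t ht
  set q := (gaussianReal 0 1).real (Ioo (-t) t)
  have hq0 : 0 ≤ q := measureReal_nonneg
  set p := Real.exp (-((t + 1) ^ 2 / 2)) / 3 with hp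
  have h2 : q ≤ Real.exp (-p) := by
    have := Real.add_one_le_exp (-p)
    linarith
  have h3 : q ^ m ≤ Real.exp (-p) ^ m := by gcongr
  have h4 : 1 ≤ m * p := by
    rw [hp, Real.exp_neg]
    have hpos := Real.exp_pos ((t + 1) ^ 2 / 2)
    have : (m : ℝ) * ((Real.exp ((t + 1) ^ 2 / 2))⁻¹ / 3) = m / (3 * Real.exp ((t + 1) ^ 2 / 2)) := by
      field_simp
    rw [this, le_div_iff₀ (by positivity)]
    linarith
  rw [← Real.exp_nat_mul] at h3
  have h5 : Real.exp (m * -p) ≤ Real.exp (-1) := by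
    rw [Real.exp_le_exp]; linarith
  have h6 := Real.exp_neg_one_lt_half
  linarith

theorem gauss_mean_lower {X : Type*} [NormedAddCommGroup X] [NormedSpace ℝ X] (m : ℕ)
    (T : EuclideanSpace ℝ (Fin m) →L[ℝ] X)
    (hT : ∀ j, 2 / 5 ≤ ‖T (EuclideanSpace.basisFun (Fin m) ℝ j)‖) (t : ℝ) (ht : 0 ≤ t)
    (hm : 3 * Real.exp ((t + 1) ^ 2 / 2) ≤ m)
    (hIntg : Integrable (fun x => ‖T x‖) (stdGaussian (EuclideanSpace ℝ (Fin m)))) :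
    t / 5 ≤ ∫ x, ‖T x‖ ∂(stdGaussian (EuclideanSpace ℝ (Fin m))) := by
  set μ := (Measure.pi (fun _ : Fin m => gaussianReal 0 1)) with hμ
  set N : (Fin m → ℝ) → ℝ := fun x => ‖T (WithLp.toLp 2 x)‖ with hN
  have hNc : Continuous N := by fun_prop
  have hTm : Measurable (fun x : EuclideanSpace ℝ (Fin m) => ENNReal.ofReal ‖T x‖) :=
    ENNReal.measurable_ofReal.comp (Continuous.measurable (by fun_prop))
  have hM0 : 0 ≤ ∫ x, ‖T x‖ ∂(stdGaussian (EuclideanSpace ℝ (Fin m))) :=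
    integral_nonneg fun x => norm_nonneg _
  rw [← ENNReal.ofReal_le_ofReal_iff hM0,
    ofReal_integral_eq_lintegral_ofReal hIntg (Filter.Eventually.of_forall fun x => norm_nonneg _),
    ← map_pi_eq_stdGaussian, lintegral_map hTm (by fun_prop)]
  change _ ≤ ∫⁻ x, ENNReal.ofReal (N x) ∂μ
  have hNm : Measurable (fun x => ENNReal.ofReal (N x)) :=
    ENNReal.measurable_ofReal.comp hNc.measurable
  let A : Fin m → Set (Fin m → ℝ) := fun j => {x | t ≤ |x j| ∧ ∀ i < j, |x i| < t}
  have hAm : ∀ j, MeasurableSet (A j) := by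
    intro j
    have : A j = {x | t ≤ |x j|} ∩ ⋂ i, ⋂ (_ : i < j), {x : Fin m → ℝ | |x i| < t} := by
      ext x; simp [A]
    rw [this]
    refine MeasurableSet.inter (measurableSet_le measurable_const (by fun_prop)) ?_
    exact MeasurableSet.iInter fun i => MeasurableSet.iInter fun _ =>
      measurableSet_lt (by fun_prop) measurable_const
  have hAd : Pairwise (Function.onFun Disjoint A) := by
    intro i j hij
    rw [Function.onFun, Set.disjoint_left]
    intro x hxi hxj
    rcases lt_or_gt_of_ne hij with h | h
    · exact absurd hxi.1 (not_le.2 (hxj.2 i h))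
    · exact absurd hxj.1 (not_le.2 (hxi.2 j h))
  have hU : {x : Fin m → ℝ | ∃ j, t ≤ |x j|} ⊆ ⋃ j, A j := by
    rintro x ⟨j, hj⟩
    have hne : ({i | t ≤ |x i|} : Set (Fin m)).Nonempty := ⟨j, hj⟩
    obtain ⟨i, hi, hmin⟩ := WellFounded.has_min (wellFounded_lt (α := Fin m)) _ hne
    refine mem_iUnion.2 ⟨i, hi, fun l hl => ?_⟩
    by_contra! hcon
    exact hmin l hcon hl
  let τ : Fin m → (Fin m → ℝ) → (Fin m → ℝ) := fun j x i => if i = j then x i else - x i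
  have hτ : ∀ j, MeasurePreserving (τ j) μ μ := by
    intro j
    refine measurePreserving_pi _ _ (f := fun i (y : ℝ) => if i = j then y else -y) ?_
    intro i
    by_cases h : i = j
    · simp only [h, if_true]; exact MeasurePreserving.id _
    · simp only [h, if_false]
      refine ⟨by fun_prop, ?_⟩
      rw [gaussianReal_map_neg, neg_zero]
  have hA : ∀ j, ENNReal.ofReal (2 / 5 * t) * μ (A j) ≤ ∫⁻ x in A j, ENNReal.ofReal (N x) ∂μ := by
    intro j
    have hpre : τ j ⁻¹' (A j) = A j := by
      ext x
      have : ∀ i, |τ j x i| = |x i| := by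
        intro i; simp only [τ]; split_ifs <;> simp
      simp [A, this]
    have h1 : ∫⁻ x in A j, ENNReal.ofReal (N (τ j x)) ∂μ = ∫⁻ x in A j, ENNReal.ofReal (N x) ∂μ := by
      have := (hτ j).setLIntegral_comp_preimage (hAm j) hNm
      rwa [hpre] at this
    have h2 : 2 * (ENNReal.ofReal (2 / 5 * t) * μ (A j)) ≤
        ∫⁻ x in A j, (ENNReal.ofReal (N x) + ENNReal.ofReal (N (τ j x))) ∂μ := by
      have h3 : 2 * (ENNReal.ofReal (2 / 5 * t) * μ (A j)) =
          ∫⁻ x in A j, ENNReal.ofReal (2 * (2 / 5 * t)) ∂μ := by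
        rw [setLIntegral_const, ENNReal.ofReal_mul (p := 2) (q := 2 / 5 * t) (by norm_num), ENNReal.ofReal_ofNat, mul_assoc]
      rw [h3]
      apply setLIntegral_mono' (hAm j)
      intro x hx
      rw [← ENNReal.ofReal_add (norm_nonneg _) (norm_nonneg _)]
      apply ENNReal.ofReal_le_ofReal
      have h4 : T (WithLp.toLp 2 x) + T (WithLp.toLp 2 (τ j x)) =
          (2 * x j) • T (EuclideanSpace.basisFun (Fin m) ℝ j) := by
        rw [← map_add, ← map_smul]
        congr 1
        ext i
        simp only [τ, PiLp.add_apply, PiLp.smul_apply, EuclideanSpace.basisFun_apply,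
          PiLp.single_apply, smul_eq_mul]
        split_ifs with h
        · subst h; ring
        · ring
      have h5 := norm_add_le (T (WithLp.toLp 2 x)) (T (WithLp.toLp 2 (τ j x)))
      rw [h4, norm_smul, Real.norm_eq_abs, abs_mul, abs_two] at h5
      have h6 : t ≤ |x j| := hx.1
      have h7 := hT j
      have h8 : t * (2 / 5) ≤ |x j| * ‖T (EuclideanSpace.basisFun (Fin m) ℝ j)‖ := by gcongr
      linarith
    rw [lintegral_add_left hNm, h1, ← two_mul] at h2
    exact (ENNReal.mul_le_mul_iff_right (by norm_num) (by norm_num)).1 h2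
  calc ENNReal.ofReal (t / 5) = ENNReal.ofReal (2 / 5 * t) * ENNReal.ofReal (1 / 2) := by
        rw [← ENNReal.ofReal_mul (by positivity)]; congr 1; ring
    _ ≤ ENNReal.ofReal (2 / 5 * t) * μ (⋃ j, A j) := by
        gcongr
        exact (gauss_max_lower m t ht hm).trans (measure_mono hU)
    _ = ∑ j, ENNReal.ofReal (2 / 5 * t) * μ (A j) := by
        rw [measure_iUnion hAd hAm, tsum_fintype, Finset.mul_sum]
    _ ≤ ∑ j, ∫⁻ x in A j, ENNReal.ofReal (N x) ∂μ := Finset.sum_le_sum fun j _ => hA j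
    _ = ∫⁻ x in ⋃ j, A j, ENNReal.ofReal (N x) ∂μ := by
        rw [lintegral_iUnion hAm hAd, tsum_fintype]
    _ ≤ ∫⁻ x, ENNReal.ofReal (N x) ∂μ := setLIntegral_le_lintegral _ _

theorem vertex_bound {ι : Type*} [Fintype ι] (f : (ι → ℝ) → ℝ) (hf : ConvexOn ℝ univ f)
    (r B : ℝ) (hr : 0 ≤ r)
    (hv : ∀ σ : ι → ℤ, (∀ i, |σ i| ≤ 1) → f (fun i => r * σ i) ≤ B) (s : ι → ℝ) (hs : ‖s‖ ≤ r) :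
    f s ≤ B := by
  have h1 : s ∈ convexHull ℝ (univ.pi (fun _ : ι => ({-r, r} : Set ℝ))) := by
    rw [convexHull_pi, mem_univ_pi]
    intro i
    rw [convexHull_pair, segment_eq_Icc (by linarith)]
    have := (pi_norm_le_iff_of_nonneg hr).1 hs i
    rw [Real.norm_eq_abs, abs_le] at this
    exact this
  obtain ⟨v, hv1, hv2⟩ := hf.exists_ge_of_mem_convexHull (subset_univ _) h1
  refine hv2.trans ?_
  have h2 : ∀ i, ∃ z : ℤ, |z| ≤ 1 ∧ v i = r * z := by
    intro i
    rcases (mem_univ_pi.1 hv1 i) with h | h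
    · exact ⟨-1, by norm_num, by rw [h]; push_cast; ring⟩
    · exact ⟨1, by norm_num, by rw [mem_singleton_iff.1 h]; push_cast; ring⟩
  choose σ h3 h4 using h2
  have := hv σ h3
  rwa [← (funext h4 : v = _)] at this

theorem two_sided {ι : Type*} [Fintype ι] (f : (ι → ℝ) → ℝ) (hf : ConvexOn ℝ univ f)
    (p : ι) (A ε : ℝ) (hε : 0 < ε)
    (hv : ∀ σ : ι → ℤ, (∀ i, |σ i| ≤ 1) →
      f (fun i => 2 * ε * σ i) ≤ A + 2 * ε * σ p + ε / 8)
    (h0 : A - ε / 20 ≤ f 0) (s : ι → ℝ) (hs : ‖s‖ ≤ 2 * ε) :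
    |f s - A - s p| ≤ ε / 4 := by
  have hup : ∀ s : ι → ℝ, ‖s‖ ≤ 2 * ε → f s - s p ≤ A + ε / 8 := by
    intro s hs
    refine vertex_bound (fun s => f s - s p) ?_ (2 * ε) _ (by positivity) ?_ s hs
    · have h2 : ConcaveOn ℝ univ (fun s : ι → ℝ => s p) := by
        refine ⟨convex_univ, ?_⟩
        intro x _ y _ a b _ _ hab
        simp
      exact hf.sub h2
    · intro σ hσ
      have := hv σ hσ
      linarith
  have h1 := hup s hs
  have h2 := hup (-s) (by rwa [norm_neg])
  have h3 := hf.2 (mem_univ s) (mem_univ (-s)) (by norm_num : (0:ℝ) ≤ 1/2)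
    (by norm_num : (0:ℝ) ≤ 1/2) (by norm_num)
  simp only [smul_neg, add_neg_cancel, smul_eq_mul] at h3
  simp only [Pi.neg_apply] at h2
  rw [abs_le]
  constructor <;> linarith

/-- coefficients of the perturbed points -/
def pcoef {k : ℕ} (s : Fin k × Fin k → ℝ) (i : Fin k) : Fin k → ℝ := fun l =>
  if l = i then 1 + s (i, i) else if l < i then s (i, i) + s (l, l) - s (l, i) else 0

theorem pcoef_affine {k : ℕ} (s s' : Fin k × Fin k → ℝ) (i : Fin k) (a b : ℝ) (hab : a + b = 1) :
    pcoef (a • s + b • s') i = a • pcoef s i + b • pcoef s' i := by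
  obtain rfl : b = 1 - a := by linarith
  ext l
  simp only [pcoef, Pi.add_apply, Pi.smul_apply, smul_eq_mul]
  split_ifs <;> ring

theorem equi_of_good {X : Type*} [NormedAddCommGroup X] [NormedSpace ℝ X] (k : ℕ)
    (ε M : ℝ) (hε : 0 < ε) (hkε : 1000 * k * ε ≤ 1) (hM : 0 < M) (G : (Fin k → ℝ) →ₗ[ℝ] X)
    (hG : ∀ c : Fin k → ℝ, (∀ l, ∃ a b : ℤ, |a| ≤ 1 ∧ |b| ≤ 6 ∧ c l = a + 2 * ε * b) →
      ∑ l, c l ^ 2 ≤ 4 → |‖G c‖ - M * √(∑ l, c l ^ 2)| ≤ ε / 50 * M) :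
    ∃ p : Fin k → X, (∀ i, ‖p i‖ = 1) ∧ ∀ i j, i ≠ j → ‖p i - p j‖ = √2 := by
  have hs2 : √2 ^ 2 = 2 := Real.sq_sqrt (by norm_num)
  have hs2pos : 0 < √2 := Real.sqrt_pos.2 (by norm_num)
  have hs2le : √2 ≤ 3 / 2 := by
    rw [Real.sqrt_le_left (by norm_num)]; norm_num
  -- functions
  let V : Fin k × Fin k → (Fin k × Fin k → ℝ) → (Fin k → ℝ) := fun q s =>
    if q.1 = q.2 then pcoef s q.1 else pcoef s q.2 - pcoef s q.1
  let C : Fin k × Fin k → ℝ := fun q => if q.1 = q.2 then 1 else √2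
  let F : Fin k × Fin k → (Fin k × Fin k → ℝ) → ℝ := fun q s =>
    if q.1 ≤ q.2 then C q / M * ‖G (V q s)‖ else s q
  let A : Fin k × Fin k → ℝ := fun q =>
    if q.1 = q.2 then 1 else if q.1 < q.2 then 2 else 0
  have hC0 : ∀ q, 0 ≤ C q := by intro q; simp only [C]; split_ifs <;> positivity
  have hC1 : ∀ q, C q ≤ 3 / 2 := by
    intro q; simp only [C]; split_ifs
    · norm_num
    · exact hs2le
  have hV : ∀ q s s' (a b : ℝ), a + b = 1 → V q (a • s + b • s') = a • V q s + b • V q s' := by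
    intro q s s' a b hab
    simp only [V]
    split_ifs
    · exact pcoef_affine _ _ _ _ _ hab
    · rw [pcoef_affine _ _ _ _ _ hab, pcoef_affine _ _ _ _ _ hab]; module
  have hFconv : ∀ q, ConvexOn ℝ univ (F q) := by
    intro q
    refine ⟨convex_univ, ?_⟩
    intro s _ s' _ a b ha hb hab
    simp only [F]
    split_ifs
    · rw [hV q s s' a b hab, map_add, map_smul, map_smul]
      have h1 := norm_add_le (a • G (V q s)) (b • G (V q s'))
      rw [norm_smul, norm_smul, Real.norm_of_nonneg ha, Real.norm_of_nonneg hb] at h1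
      have h2 : 0 ≤ C q / M := div_nonneg (hC0 q) hM.le
      have h3 := mul_le_mul_of_nonneg_left h1 h2
      simp only [smul_eq_mul]
      linarith
    · simp
  -- integrality of the coefficients
  have hIntg : ∀ q (σ : Fin k × Fin k → ℤ), (∀ r, |σ r| ≤ 1) → ∀ l, ∃ a b : ℤ, |a| ≤ 1 ∧ |b| ≤ 6 ∧
      V q (fun r => 2 * ε * σ r) l = a + 2 * ε * b := by
    intro q σ hσ l
    have hσ' : ∀ r, -1 ≤ σ r ∧ σ r ≤ 1 := fun r => abs_le.1 (hσ r)
    simp only [V]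
    by_cases h : q.1 = q.2
    · simp only [h, if_true, pcoef]
      have h1 := hσ' (q.2, q.2); have h2 := hσ' (l, l); have h3 := hσ' (l, q.2)
      split_ifs
      · exact ⟨1, σ (q.2, q.2), by norm_num, by rw [abs_le]; omega, by push_cast; ring⟩
      · exact ⟨0, σ (q.2, q.2) + σ (l, l) - σ (l, q.2), by norm_num, by rw [abs_le]; omega,
          by push_cast; ring⟩
      · exact ⟨0, 0, by norm_num, by norm_num, by push_cast; ring⟩
    · simp only [h, if_false, pcoef, Pi.sub_apply]
      have h1 := hσ' (q.2, q.2); have h2 := hσ' (l, l); have h3 := hσ' (l, q.2)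
      have h4 := hσ' (q.1, q.1); have h5 := hσ' (l, q.1)
      split_ifs with h6 h7 h8 h9 h10 h11
      · exact absurd (h7.symm.trans h6) h
      · exact ⟨1, σ (q.2, q.2) - (σ (q.1, q.1) + σ (l, l) - σ (l, q.1)), by norm_num,
          by rw [abs_le]; omega, by push_cast; ring⟩
      · exact ⟨1, σ (q.2, q.2), by norm_num, by rw [abs_le]; omega, by push_cast; ring⟩
      · exact ⟨-1, σ (q.2, q.2) + σ (l, l) - σ (l, q.2) - σ (q.1, q.1), by norm_num,
          by rw [abs_le]; omega, by push_cast; ring⟩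
      · exact ⟨0, σ (q.2, q.2) + σ (l, l) - σ (l, q.2) - (σ (q.1, q.1) + σ (l, l) - σ (l, q.1)),
          by norm_num, by rw [abs_le]; omega, by push_cast; ring⟩
      · exact ⟨0, σ (q.2, q.2) + σ (l, l) - σ (l, q.2),
          by norm_num, by rw [abs_le]; omega, by push_cast; ring⟩
      · exact ⟨-1, - σ (q.1, q.1), by norm_num, by rw [abs_le]; omega, by push_cast; ring⟩
      · exact ⟨0, - (σ (q.1, q.1) + σ (l, l) - σ (l, q.1)),
          by norm_num, by rw [abs_le]; omega, by push_cast; ring⟩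
      · exact ⟨0, 0, by norm_num, by norm_num, by push_cast; ring⟩
  -- square sums
  have hsum : ∀ q : Fin k × Fin k, q.1 ≤ q.2 → ∀ s : Fin k × Fin k → ℝ, (∀ r, |s r| ≤ 2 * ε) →
      C q ^ 2 * ∑ l, V q s l ^ 2 ≤ A q ^ 2 + 2 * A q * s q + 168 * k * ε ^ 2 := by
    intro q hq s hs
    have hk1 : (1 : ℝ) ≤ k := by
      have : 0 < k := lt_of_le_of_lt (Nat.zero_le _) q.1.2
      exact_mod_cast this
    have hs' : ∀ r, - (2 * ε) ≤ s r ∧ s r ≤ 2 * ε := fun r => abs_le.1 (hs r)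
    obtain ⟨j, i⟩ := q
    simp only at hq
    have g1 := hs' (i, i)
    have g2 := hs' (j, i)
    have hsq : ∀ x y : ℝ, -y ≤ x → x ≤ y → x ^ 2 ≤ y ^ 2 := fun x y h1 h2 => sq_le_sq' h1 h2
    rcases eq_or_lt_of_le hq with h | h
    · subst h
      have h1 : ∀ l, V (j, j) s l ^ 2 ≤ (if l = j then (1 + s (j, j)) ^ 2 else 0) + (6 * ε) ^ 2 := by
        intro l
        simp only [V, pcoef, if_true]
        have f2 := hs' (l, l); have f3 := hs' (l, j)
        split_ifs
        · nlinarith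
        · rw [zero_add]; apply hsq <;> linarith
        · rw [zero_add]; apply hsq <;> linarith
      have h2 := Finset.sum_le_sum (fun l (_ : l ∈ Finset.univ) => h1 l)
      rw [Finset.sum_add_distrib] at h2
      simp only [Finset.sum_ite_eq', Finset.mem_univ, if_true, Finset.sum_const, Finset.card_univ,
        Fintype.card_fin, nsmul_eq_mul] at h2
      simp only [C, A, if_true]
      have h3 := hsq _ _ g1.1 g1.2
      nlinarith [sq_nonneg ε]
    · have hne : j ≠ i := h.ne
      have h1 : ∀ l, V (j, i) s l ^ 2 ≤ (if l = i then (1 + s (i, i)) ^ 2 else 0) +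
          (if l = j then (1 + s (j, i) - s (i, i)) ^ 2 else 0) + (8 * ε) ^ 2 := by
        intro l
        simp only [V, pcoef, hne, if_false, Pi.sub_apply]
        have f2 := hs' (l, l); have f3 := hs' (l, j); have f4 := hs' (l, i)
        have f5 := hs' (j, j)
        by_cases hli : l = i
        · have h5 : ¬ (i = j) := fun h => hne h.symm
          have h6 : ¬ (i < j) := not_lt.2 h.le
          simp only [hli, if_true, h5, h6, if_false]
          nlinarith
        by_cases hlj : l = j
        · simp only [hlj, hne, if_true, if_false, h]
          nlinarith
        simp only [hli, hlj, if_false, zero_add]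
        split_ifs
        · apply hsq <;> linarith
        · apply hsq <;> linarith
        · apply hsq <;> linarith
        · apply hsq <;> linarith
      have h2 := Finset.sum_le_sum (fun l (_ : l ∈ Finset.univ) => h1 l)
      rw [Finset.sum_add_distrib, Finset.sum_add_distrib] at h2
      simp only [Finset.sum_ite_eq', Finset.mem_univ, if_true, Finset.sum_const, Finset.card_univ,
        Fintype.card_fin, nsmul_eq_mul] at h2
      simp only [C, A, hne, h, if_true, if_false, hs2]
      have h3 := hsq _ _ g1.1 g1.2
      have h4 := hsq (s (j, i) - s (i, i)) (4 * ε) (by linarith) (by linarith)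
      nlinarith [sq_nonneg ε]
  have hsum0 : ∀ q : Fin k × Fin k, q.1 ≤ q.2 →
      C q ^ 2 * ∑ l, V q 0 l ^ 2 = A q ^ 2 := by
    rintro ⟨j, i⟩ hq
    simp only at hq
    rcases eq_or_lt_of_le hq with h | h
    · subst h
      have h1 : ∀ l, V (j, j) 0 l ^ 2 = (if l = j then 1 else 0) := by
        intro l
        simp only [V, pcoef, if_true]
        split_ifs <;> simp
      simp [h1, C, A]
    · have hne : j ≠ i := h.ne
      have h1 : ∀ l, V (j, i) 0 l ^ 2 = (if l = i then 1 else 0) + (if l = j then 1 else 0) := by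
        intro l
        simp only [V, pcoef, hne, if_false, Pi.sub_apply]
        by_cases hli : l = i
        · have h5 : ¬ (i = j) := fun h => hne h.symm
          simp [hli, h5]
        · by_cases hlj : l = j
          · simp [hlj, hne]
          · simp [hli, hlj]
      simp only [h1, Finset.sum_add_distrib, Finset.sum_ite_eq', Finset.mem_univ, if_true, C, A, hne,
        h, if_false, hs2]
      norm_num
  have hA : ∀ q : Fin k × Fin k, q.1 ≤ q.2 → 1 ≤ A q ∧ A q ≤ 2 := by
    rintro ⟨j, i⟩ hq
    simp only at hq
    rcases eq_or_lt_of_le hq with h | h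
    · simp [A, h]
    · simp [A, h, h.ne]
  have hCA : ∀ q : Fin k × Fin k, q.1 ≤ q.2 → A q ^ 2 = 2 * C q ^ 2 ∨ A q ^ 2 = C q ^ 2 := by
    rintro ⟨j, i⟩ hq
    simp only at hq
    rcases eq_or_lt_of_le hq with h | h
    · right; simp [A, C, h]
    · left; simp only [A, C, h.ne, h, if_true, if_false, hs2]; norm_num
  have hCone : ∀ q, 1 ≤ C q := by
    intro q; simp only [C]; split_ifs
    · norm_num
    · rw [Real.one_le_sqrt]; norm_num
  -- conclusion of the estimates
  have hmain : ∀ q s, ‖s‖ ≤ 2 * ε → |F q s - A q - s q| ≤ ε / 4 := by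
    intro q s hs
    by_cases hq : q.1 ≤ q.2
    · have hk1 : (1 : ℝ) ≤ k := by
        have : 0 < k := lt_of_le_of_lt (Nat.zero_le _) q.1.2
        exact_mod_cast this
      have hε1 : ε ≤ 1 / 1000 := by nlinarith
      have hkε2 : 1000 * k * ε ^ 2 ≤ ε := by nlinarith
      obtain ⟨hA1, hA2⟩ := hA q hq
      have hCpos : 0 < C q := by linarith [hCone q]
      have hFq : ∀ s, F q s = C q / M * ‖G (V q s)‖ := by
        intro s; simp only [F, hq, if_true]
      have happ : ∀ σ : Fin k × Fin k → ℤ, (∀ r, |σ r| ≤ 1) →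
          |F q (fun r => 2 * ε * σ r) - √(C q ^ 2 * ∑ l, V q (fun r => 2 * ε * σ r) l ^ 2)| ≤
            3 * ε / 100 := by
        intro σ hσ
        have hb : ∀ r, |2 * ε * (σ r : ℝ)| ≤ 2 * ε := by
          intro r
          rw [abs_mul, abs_of_pos (by positivity : 0 < 2 * ε)]
          have : |(σ r : ℝ)| ≤ 1 := by exact_mod_cast hσ r
          nlinarith
        have h1 := hsum q hq _ hb
        have h4 : ∑ l, V q (fun r => 2 * ε * σ r) l ^ 2 ≤ 4 := by
          have h2 := (abs_le.1 (hb q)).2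
          have h3 : A q ^ 2 + 2 * A q * (2 * ε * σ q) + 168 * k * ε ^ 2 ≤ A q ^ 2 + 1 := by
            nlinarith
          have h5 : 1 ≤ C q ^ 2 := one_le_pow₀ (hCone q)
          rcases hCA q hq with h6 | h6 <;> nlinarith
        have h2 := hG _ (hIntg q σ hσ) h4
        rw [hFq, Real.sqrt_mul (sq_nonneg _), Real.sqrt_sq hCpos.le]
        set c := V q (fun r => 2 * ε * σ r)
        have h5 : C q / M * ‖G c‖ - C q * √(∑ l, c l ^ 2) =
            C q / M * (‖G c‖ - M * √(∑ l, c l ^ 2)) := by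
          field_simp
        rw [h5, abs_mul, abs_of_pos (by positivity)]
        calc C q / M * |‖G c‖ - M * √(∑ l, c l ^ 2)| ≤ C q / M * (ε / 50 * M) := by gcongr
          _ = C q * (ε / 50) := by field_simp
          _ ≤ 3 / 2 * (ε / 50) := by gcongr; exact hC1 q
          _ = 3 * ε / 100 := by ring
      refine two_sided (F q) (hFconv q) q (A q) ε hε ?_ ?_ s hs
      · intro σ hσ
        have hb : ∀ r, |2 * ε * (σ r : ℝ)| ≤ 2 * ε := by
          intro r
          rw [abs_mul, abs_of_pos (by positivity : 0 < 2 * ε)]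
          have : |(σ r : ℝ)| ≤ 1 := by exact_mod_cast hσ r
          nlinarith
        have h1 := hsum q hq _ hb
        have h2 := (abs_le.1 (happ σ hσ)).2
        have hbq := abs_le.1 (hb q)
        have h3 : √(C q ^ 2 * ∑ l, V q (fun r => 2 * ε * σ r) l ^ 2) ≤
            A q + 2 * ε * σ q + 9 * ε / 100 := by
          apply Real.sqrt_le_iff.2
          constructor
          · nlinarith
          · refine h1.trans ?_
            set y := 2 * ε * (σ q : ℝ)
            nlinarith [sq_nonneg (y + 9 * ε / 100), mul_nonneg (sub_nonneg.2 hA1) hε.le, hkε2]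
        linarith
      · have h1 := (abs_le.1 (happ 0 (by simp))).1
        have h2 : (fun r : Fin k × Fin k => 2 * ε * ((0 : Fin k × Fin k → ℤ) r : ℝ)) = 0 := by
          ext r; simp
        rw [h2, hsum0 q hq, Real.sqrt_sq (by linarith)] at h1
        linarith
    · have h1 : ¬ (q.1 = q.2) := fun h => hq h.le
      have h2 : ¬ (q.1 < q.2) := fun h => hq h.le
      simp only [F, A, hq, h1, h2, if_false, sub_zero, sub_self, abs_zero]
      positivity
  obtain ⟨s, -, hs⟩ := fp_lemma F A ε (ε / 4) hε (by positivity) le_rfl hFconv hmain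
  refine ⟨fun i => M⁻¹ • G (pcoef s i), ?_, ?_⟩
  · intro i
    have := hs (i, i)
    simp only [F, A, C, V, le_refl, if_true] at this
    rw [norm_smul, norm_inv, Real.norm_of_nonneg hM.le]
    rwa [one_div] at this
  · have hlt : ∀ i j : Fin k, j < i → ‖M⁻¹ • G (pcoef s i) - M⁻¹ • G (pcoef s j)‖ = √2 := by
      intro i j h
      have := hs (j, i)
      simp only [F, A, C, V, h.le, h, h.ne, if_true, if_false] at this
      rw [← smul_sub, ← map_sub, norm_smul, norm_inv, Real.norm_of_nonneg hM.le]
      have h2 : √2 * (M⁻¹ * ‖G (pcoef s i - pcoef s j)‖) = √2 * √2 := by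
        calc _ = √2 / M * ‖G (pcoef s i - pcoef s j)‖ := by ring
          _ = 2 := this
          _ = √2 * √2 := by rw [← sq, hs2]
      exact mul_left_cancel₀ hs2pos.ne' h2
    intro i j hij
    rcases lt_or_gt_of_ne hij with h | h
    · rw [norm_sub_rev]; exact hlt j i h
    · exact hlt i j h

section randomstep
variable {E : Type*} [NormedAddCommGroup E] [InnerProductSpace ℝ E] [FiniteDimensional ℝ E]
  [MeasurableSpace E] [BorelSpace E]
variable {X : Type*} [NormedAddCommGroup X] [NormedSpace ℝ X]

theorem bad_bound {k : ℕ} (T : E →L[ℝ] X) (hT : ‖T‖ ≤ 1) (d : ℝ) (hd : 0 < d)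
    (c : Fin k → ℝ) (hc : ∑ l, c l ^ 2 ≤ 4) :
    (Measure.pi (fun _ : Fin k => stdGaussian E))
      {ω | d < |‖T (∑ l, c l • ω l)‖ - (∫ y, ‖T y‖ ∂(stdGaussian E)) * √(∑ l, c l ^ 2)|} ≤
      ENNReal.ofReal (4 * Real.exp (- (d ^ 2 / 20))) := by
  set M := ∫ y, ‖T y‖ ∂(stdGaussian E) with hM
  set r := √(∑ l, c l ^ 2) with hr
  have hr0 : 0 ≤ r := Real.sqrt_nonneg _
  have hr2 : r ^ 2 ≤ 4 := by
    rw [hr, Real.sq_sqrt (Finset.sum_nonneg fun l _ => sq_nonneg _)]; exact hc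
  have hms : Measurable (fun ω : Fin k → E => ∑ l, c l • ω l) :=
    Finset.measurable_sum _ (fun l _ => (measurable_pi_apply l).const_smul (c l))
  have hBm : MeasurableSet {y : E | d < |‖T y‖ - M * r|} :=
    (isOpen_lt continuous_const (by fun_prop)).measurableSet
  have h1 : (Measure.pi (fun _ : Fin k => stdGaussian E))
      {ω | d < |‖T (∑ l, c l • ω l)‖ - M * r|} =
      (stdGaussian E) {x | d < |‖T (r • x)‖ - M * r|} := by
    have h2 := congrArg (fun μ : Measure E => μ {y : E | d < |‖T y‖ - M * r|})
      (gauss_comb (E := E) c)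
    rw [Measure.map_apply hms hBm, Measure.map_apply (by fun_prop) hBm] at h2
    exact h2
  rw [h1]
  rcases eq_or_lt_of_le hr0 with h0 | h0
  · rw [← h0]
    simp [not_lt.2 hd.le]
  · refine le_trans (measure_mono ?_) ((gauss_conc T hT (d / r) (by positivity)).trans ?_)
    · intro x hx
      simp only [mem_ofPred_eq] at hx ⊢
      rw [map_smul, norm_smul, Real.norm_of_nonneg hr0, mul_comm M r, ← mul_sub, abs_mul,
        abs_of_pos h0] at hx
      rw [div_le_iff₀ h0]
      linarith
    · apply ENNReal.ofReal_le_ofReal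
      have h5 : d ^ 2 / 20 ≤ (d / r) ^ 2 / 5 := by
        rw [div_pow, div_div]
        gcongr
        linarith
      have h6 := Real.exp_le_exp.2 (neg_le_neg h5)
      linarith

theorem random_good {k : ℕ} (T : E →L[ℝ] X) (hT : ‖T‖ ≤ 1) (ε d : ℝ) (hd : 0 < d)
    (hk : 39 ^ k * (4 * Real.exp (- (d ^ 2 / 20))) < 1) :
    ∃ G : (Fin k → ℝ) →ₗ[ℝ] X, ∀ c : Fin k → ℝ,
      (∀ l, ∃ a b : ℤ, |a| ≤ 1 ∧ |b| ≤ 6 ∧ c l = a + 2 * ε * b) →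
      ∑ l, c l ^ 2 ≤ 4 →
      |‖G c‖ - (∫ y, ‖T y‖ ∂(stdGaussian E)) * √(∑ l, c l ^ 2)| ≤ d := by
  set M := ∫ y, ‖T y‖ ∂(stdGaussian E) with hM
  set ν := Measure.pi (fun _ : Fin k => stdGaussian E) with hν
  let cc : (Fin k → Fin 3 × Fin 13) → Fin k → ℝ := fun φ l =>
    ((((φ l).1 : ℕ) : ℝ) - 1) + 2 * ε * ((((φ l).2 : ℕ) : ℝ) - 6)
  let B : (Fin k → Fin 3 × Fin 13) → Set (Fin k → E) := fun φ =>
    {ω | ∑ l, cc φ l ^ 2 ≤ 4 ∧ d < |‖T (∑ l, cc φ l • ω l)‖ - M * √(∑ l, cc φ l ^ 2)|}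
  have hB : ∀ φ, ν (B φ) ≤ ENNReal.ofReal (4 * Real.exp (- (d ^ 2 / 20))) := by
    intro φ
    by_cases h : ∑ l, cc φ l ^ 2 ≤ 4
    · refine (measure_mono ?_).trans (bad_bound T hT d hd (cc φ) h)
      intro ω hω
      exact hω.2
    · have : B φ = ∅ := by
        ext ω
        simp [B, h]
      rw [this]; simp
  have hU : ν (⋃ φ, B φ) < 1 := by
    calc ν (⋃ φ, B φ) ≤ ∑ φ, ν (B φ) := measure_iUnion_fintype_le _ _
      _ ≤ ∑ φ : Fin k → Fin 3 × Fin 13, ENNReal.ofReal (4 * Real.exp (- (d ^ 2 / 20))) :=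
        Finset.sum_le_sum fun φ _ => hB φ
      _ = ENNReal.ofReal (39 ^ k * (4 * Real.exp (- (d ^ 2 / 20)))) := by
        rw [Finset.sum_const, Finset.card_univ, ← ENNReal.ofReal_nsmul]
        congr 1
        simp
      _ < 1 := by rw [← ENNReal.ofReal_one]; exact (ENNReal.ofReal_lt_ofReal_iff one_pos).2 hk
  obtain ⟨ω, hω⟩ : ∃ ω, ω ∉ ⋃ φ, B φ := by
    by_contra! h
    have h2 : (⋃ φ, B φ) = univ := eq_univ_of_forall h
    rw [h2, measure_univ] at hU
    exact lt_irrefl _ hU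
  let G : (Fin k → ℝ) →ₗ[ℝ] X := T.toLinearMap.comp (Fintype.linearCombination ℝ ω)
  refine ⟨G, ?_⟩
  intro c hc hc4
  have hGc : G c = T (∑ l, c l • ω l) := by simp [G, Fintype.linearCombination_apply]
  have h3 : ∃ φ, cc φ = c := by
    choose a b ha hb hab using hc
    have ha' := fun l => abs_le.1 (ha l)
    have hb' := fun l => abs_le.1 (hb l)
    refine ⟨fun l => (⟨(a l + 1).toNat, ?_⟩, ⟨(b l + 6).toNat, ?_⟩), ?_⟩
    · have := ha' l; omega
    · have := hb' l; omega
    · ext l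
      have h4 : (((a l + 1).toNat : ℕ) : ℝ) = a l + 1 := by
        have : (((a l + 1).toNat : ℕ) : ℤ) = a l + 1 := Int.toNat_of_nonneg (by have := ha' l; omega)
        exact_mod_cast this
      have h5 : (((b l + 6).toNat : ℕ) : ℝ) = b l + 6 := by
        have : (((b l + 6).toNat : ℕ) : ℤ) = b l + 6 := Int.toNat_of_nonneg (by have := hb' l; omega)
        exact_mod_cast this
      simp only [cc, h4, h5, hab l]
      ring
  obtain ⟨φ, rfl⟩ := h3
  by_contra! h
  apply hω
  rw [mem_iUnion]
  refine ⟨φ, hc4, ?_⟩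
  rw [hGc] at h
  exact h
end randomstep

theorem equi_exists {X : Type*} [NormedAddCommGroup X] [NormedSpace ℝ X] [FiniteDimensional ℝ X]
    (n k : ℕ) (hn : finrank ℝ X = n) (hn36 : 36 ≤ n) (hlog : 4 ≤ Real.log n)
    (hk : 0 < k) (hkn : (40000 * (k : ℝ)) ^ 3 ≤ Real.log n) :
    ∃ p : Fin k → X, (∀ i, ‖p i‖ = 1) ∧ ∀ i j, i ≠ j → ‖p i - p j‖ = √2 := by
  obtain ⟨m, hm, T, hT, hTj⟩ := dvoretzky_rogers (X := X) n hn (by omega)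
  have hkR : (1 : ℝ) ≤ k := by exact_mod_cast hk
  have hnR : (36 : ℝ) ≤ n := by exact_mod_cast hn36
  have hmR : (n : ℝ) ≤ 2 * m := by exact_mod_cast hm
  set s := √(Real.log n) with hs
  have hs2 : s ^ 2 = Real.log n := Real.sq_sqrt (by linarith)
  have hs4 : 2 ≤ s := Real.le_sqrt_of_sq_le (by linarith)
  have hexp : Real.exp (Real.log n / 2) ^ 2 = n := by
    rw [← Real.exp_nat_mul]
    push_cast
    rw [mul_div_cancel₀ _ (two_ne_zero), Real.exp_log (by linarith)]
  have hmean := gauss_mean_lower m T hTj (s - 1) (by linarith) (by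
    rw [sub_add_cancel, hs2]
    set e := Real.exp (Real.log n / 2)
    have he : 0 < e := Real.exp_pos _
    have : 6 ≤ e := by nlinarith
    nlinarith) (gauss_T_integrable T)
  set M := ∫ x, ‖T x‖ ∂stdGaussian (EuclideanSpace ℝ (Fin m)) with hM
  have hM1 : s / 10 ≤ M := by linarith
  have hM0 : 0 < M := by linarith
  have hM2 : Real.log n / 100 ≤ M ^ 2 := by nlinarith
  set ε : ℝ := 1 / (1000 * k) with hε
  have hε0 : 0 < ε := by positivity
  have hd : 0 < ε / 50 * M := by positivity
  have hdd : 6 * (k : ℝ) < (ε / 50 * M) ^ 2 / 20 := by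
    have h1 : (ε / 50 * M) ^ 2 / 20 = M ^ 2 / (50000000000 * k ^ 2) := by
      rw [hε]; field_simp; norm_num
    rw [h1, lt_div_iff₀ (by positivity)]
    have : 0 < (k : ℝ) ^ 3 := by positivity
    nlinarith
  have hun : 39 ^ k * (4 * Real.exp (- ((ε / 50 * M) ^ 2 / 20))) < 1 := by
    have h2 : (2 : ℝ) ≤ Real.exp 1 := by linarith [Real.add_one_le_exp (1 : ℝ)]
    have h27 : (27 / 10 : ℝ) ≤ Real.exp 1 := by linarith [Real.exp_one_gt_d9]
    have h3 : (156 : ℝ) ≤ Real.exp 6 := by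
      have : Real.exp 6 = Real.exp 1 ^ 6 := by rw [← Real.exp_nat_mul]; norm_num
      rw [this]
      calc (156 : ℝ) ≤ (27 / 10) ^ 6 := by norm_num
        _ ≤ _ := by gcongr
    have h4 : (39 : ℝ) ^ k * 4 ≤ Real.exp (6 * k) := by
      calc (39 : ℝ) ^ k * 4 ≤ 39 ^ k * 4 ^ k := by
            gcongr
            exact le_self_pow₀ (by norm_num) hk.ne'
        _ = 156 ^ k := by rw [← mul_pow]; norm_num
        _ ≤ Real.exp 6 ^ k := by gcongr
        _ = Real.exp (6 * k) := by rw [← Real.exp_nat_mul, mul_comm]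
    calc 39 ^ k * (4 * Real.exp (- ((ε / 50 * M) ^ 2 / 20)))
        = (39 ^ k * 4) * Real.exp (- ((ε / 50 * M) ^ 2 / 20)) := by ring
      _ ≤ Real.exp (6 * k) * Real.exp (- ((ε / 50 * M) ^ 2 / 20)) := by gcongr
      _ = Real.exp (6 * k - (ε / 50 * M) ^ 2 / 20) := by rw [← Real.exp_add, sub_eq_add_neg]
      _ < 1 := by rw [Real.exp_lt_one_iff]; linarith
  obtain ⟨G, hG⟩ := random_good T hT ε (ε / 50 * M) hd hun
  refine equi_of_good k ε M hε0 ?_ hM0 G hG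
  rw [hε]; field_simp; rfl

theorem card_bdd (X : Type*) [NormedAddCommGroup X] [NormedSpace ℝ X] [FiniteDimensional ℝ X] :
    ∃ N : ℕ, ∀ S : Finset X, (S : Set X) ⊆ sphere (0 : X) 1 →
      (∀ x ∈ S, ∀ y ∈ S, x ≠ y → 1 < ‖x - y‖) → S.card ≤ N := by
  have : ProperSpace X := FiniteDimensional.proper ℝ X
  obtain ⟨t, -, htf, ht⟩ := (isCompact_sphere (0 : X) 1).finite_cover_balls
    (show (0 : ℝ) < 1 / 2 by norm_num)
  refine ⟨htf.toFinset.card, fun S hS hsep => ?_⟩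
  have h1 : ∀ x ∈ S, ∃ c ∈ t, ‖x - c‖ < 1 / 2 := by
    intro x hx
    have := ht (hS hx)
    simp only [mem_iUnion, mem_ball, dist_eq_norm] at this
    obtain ⟨c, hc, h⟩ := this
    exact ⟨c, hc, h⟩
  choose! f hf1 hf2 using h1
  apply Finset.card_le_card_of_injOn f
  · intro x hx
    simpa using hf1 x hx
  · intro x hx y hy hxy
    by_contra hne
    have h2 := hsep x hx y hy hne
    have h3 := hf2 x hx
    have h4 := hf2 y hy
    rw [← hxy, norm_sub_rev] at h4
    have h5 := norm_add_le (x - f x) (f x - y)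
    rw [sub_add_sub_cancel] at h5
    linarith

end helpers

/-- There are `κ > 0` and `n₀` such that every `n`-dimensional real
Banach space `X` with `n ≥ n₀` contains, for some `λ > 1`, a `λ`-equilateral set of unit
vectors of cardinality at least `κ·(log n)^{1/3}`; consequently
`H'_α(X) ≥ e_c(X) ≥ κ·(log n)^{1/3}`. -/
theorem ec_ge_log_pow_third :
    ∃ κ : ℝ, 0 < κ ∧ ∃ n₀ : ℕ, ∀ n : ℕ, n₀ ≤ n →
      ∀ (X : Type) [NormedAddCommGroup X] [NormedSpace ℝ X] [FiniteDimensional ℝ X],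
        Module.finrank ℝ X = n →
        (∃ lam : ℝ, 1 < lam ∧ ∃ S : Finset X, (S : Set X) ⊆ sphere (0 : X) 1 ∧
          (∀ x ∈ S, ∀ y ∈ S, x ≠ y → ‖x - y‖ = lam) ∧
          κ * (Real.log n) ^ ((1 : ℝ) / 3) ≤ (S.card : ℝ)) ∧
        κ * (Real.log n) ^ ((1 : ℝ) / 3) ≤ (ecNumber X : ℝ) ∧
        ecNumber X ≤ strictHalpha X := by
  refine ⟨1 / 80000, by norm_num, ⌈Real.exp ((80000 : ℝ) ^ 3)⌉₊, ?_⟩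
  intro n hn X _ _ _ hfin
  have hnexp : Real.exp ((80000 : ℝ) ^ 3) ≤ n := Nat.ceil_le.1 hn
  have hnpos : (0 : ℝ) < n := lt_of_lt_of_le (Real.exp_pos _) hnexp
  have hlog : (80000 : ℝ) ^ 3 ≤ Real.log n := (Real.le_log_iff_exp_le hnpos).2 hnexp
  have hlog0 : 0 ≤ Real.log n := le_trans (by positivity) hlog
  have hn36 : 36 ≤ n := by
    have h1 := Real.add_one_le_exp ((80000 : ℝ) ^ 3)
    have h2 : (36 : ℝ) ≤ n := by
      have h3 : (36 : ℝ) ≤ 80000 ^ 3 := by norm_num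
      linarith
    exact_mod_cast h2
  set L := Real.log n ^ ((1 : ℝ) / 3) with hL
  have hL3 : L ^ 3 = Real.log n := by
    rw [hL, ← Real.rpow_natCast, ← Real.rpow_mul hlog0]
    norm_num
  have hL0 : 0 ≤ L := Real.rpow_nonneg hlog0 _
  have hLbig : 80000 ≤ L := by
    by_contra! h
    have h1 : L ^ 3 < 80000 ^ 3 := pow_lt_pow_left₀ h hL0 (by norm_num)
    linarith
  set k := ⌊L / 40000⌋₊ with hk
  have hk1 : (k : ℝ) ≤ L / 40000 := Nat.floor_le (by positivity)
  have hk2 : L / 40000 < k + 1 := Nat.lt_floor_add_one _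
  have hkκ : 1 / 80000 * L ≤ (k : ℝ) := by linarith
  have hkpos : 0 < k := by
    have : (0 : ℝ) < k := by linarith
    exact_mod_cast this
  have hkn : (40000 * (k : ℝ)) ^ 3 ≤ Real.log n := by
    rw [← hL3]
    apply pow_le_pow_left₀ (by positivity)
    linarith
  obtain ⟨p, hp1, hp2⟩ := equi_exists n k hfin hn36
    (le_trans (by norm_num) hlog) hkpos hkn
  have hinj : Function.Injective p := by
    intro i j hij
    by_contra hne
    have h1 := hp2 i j hne
    rw [hij, sub_self, norm_zero] at h1
    exact absurd h1.symm (Real.sqrt_pos.2 (by norm_num)).ne'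
  have hs1 : 1 < √(2 : ℝ) := by
    rw [Real.lt_sqrt (by norm_num)]; norm_num
  have hs2 : √(2 : ℝ) ≤ 2 := by
    rw [Real.sqrt_le_left (by norm_num)]; norm_num
  let S : Finset X := Finset.univ.map ⟨p, hinj⟩
  have hScard : S.card = k := by simp [S]
  have hSsph : (S : Set X) ⊆ sphere (0 : X) 1 := by
    intro x hx
    simp only [S, Finset.coe_map, Function.Embedding.coeFn_mk, Finset.coe_univ,
      Set.image_univ, Set.mem_range] at hx
    obtain ⟨i, rfl⟩ := hx
    simp [hp1 i]
  have hSeq : ∀ x ∈ S, ∀ y ∈ S, x ≠ y → ‖x - y‖ = √2 := by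
    intro x hx y hy hxy
    simp only [S, Finset.mem_map, Finset.mem_univ, true_and, Function.Embedding.coeFn_mk] at hx hy
    obtain ⟨i, rfl⟩ := hx
    obtain ⟨j, rfl⟩ := hy
    exact hp2 i j (fun h => hxy (by rw [h]))
  obtain ⟨N, hN⟩ := card_bdd X
  have hbddA : BddAbove {k : ℕ | ∃ S : Finset X, S.card = k ∧ (S : Set X) ⊆ sphere (0 : X) 1 ∧
      StrictAntipProp (S : Set X)} := by
    refine ⟨N, ?_⟩
    rintro _ ⟨S, rfl, hS, hSA⟩
    refine hN S hS ?_
    intro x hx y hy hxy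
    obtain ⟨f, hf1, hf2, -⟩ := hSA x hx y hy hxy
    rw [← map_sub] at hf2
    have h1 : f (x - y) ≤ ‖x - y‖ :=
      (le_abs_self _).trans (by simpa using f.le_of_opNorm_le hf1 (x - y))
    linarith
  have hsub : {k : ℕ | ∃ lam : ℝ, 1 < lam ∧ lam ≤ 2 ∧ ∃ S : Finset X, S.card = k ∧
      (S : Set X) ⊆ sphere (0 : X) 1 ∧ ∀ x ∈ S, ∀ y ∈ S, x ≠ y → ‖x - y‖ = lam} ⊆
      {k : ℕ | ∃ S : Finset X, S.card = k ∧ (S : Set X) ⊆ sphere (0 : X) 1 ∧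
      StrictAntipProp (S : Set X)} := by
    rintro k ⟨lam, hlam, -, S, hSk, hS, hSe⟩
    refine ⟨S, hSk, hS, ?_⟩
    intro x hx y hy hxy
    obtain ⟨f, hf1, hf2⟩ := exists_dual_vector'' ℝ (x - y)
    have hfb : ∀ z, f z ≤ ‖z‖ := fun z =>
      (le_abs_self _).trans (by simpa using f.le_of_opNorm_le hf1 z)
    have hf3 : f x - f y = lam := by
      rw [← map_sub, hf2, hSe x hx y hy hxy]
      simp
    have hdist : ∀ z ∈ S, ∀ w ∈ S, f z - f w ≤ lam := by
      intro z hz w hw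
      by_cases h : z = w
      · rw [h]; linarith
      · rw [← map_sub, ← hSe z hz w hw h]; exact hfb _
    refine ⟨f, hf1, by linarith, ?_⟩
    intro z hz
    have h1 := hdist z hz y hy
    have h2 := hdist x hx z hz
    constructor <;> linarith
  have hec : k ≤ ecNumber X :=
    le_csSup (hbddA.mono hsub) ⟨√2, hs1, hs2, S, hScard, hSsph, hSeq⟩
  refine ⟨⟨√2, hs1, S, hSsph, hSeq, by rw [hScard]; exact hkκ⟩, ?_, ?_⟩
  · exact hkκ.trans (by exact_mod_cast hec)
  · exact csSup_le_csSup hbddA ⟨k, √2, hs1, hs2, S, hScard, hSsph, hSeq⟩ hsub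

end
end
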